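/- Let k be a number field. For every ε > 0 there is a constant depending only on k and ε such that for every squarefree integral ideal q of O_k, the sum of the relative 3-class numbers h3*(F/k) over all quadratic extensions F/k with q dividing the relative discriminant disc(F/k) and with Disc(F) ≤ X is at most O_{k,ε}(X / |q|^{1/6 − ε}); the implied constant is independent of q. -/

import Mathlib

open scoped Classical NumberField

noncomputable section

variable (k : Type*) [Field k] [NumberField k]

local notation "kbar" => AlgebraicClosure k

/-- The permutation of the embeddings of `K` into `kbar` induced by an automorphism
of `kbar` over `k` (acting by post-composition). -/
def galPerm (K : IntermediateField k kbar) (σ : kbar ≃ₐ[k] kbar) :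
    Equiv.Perm (K →ₐ[k] kbar) where
  toFun f := σ.toAlgHom.comp f
  invFun f := σ.symm.toAlgHom.comp f
  left_inv f := by ext x; simp
  right_inv f := by ext x; simp

/-- The action of the absolute Galois group of `k` on the embeddings of `K`, as a
homomorphism to the permutation group of the embeddings.  Its image is isomorphic to the
Galois group of the Galois closure of `K` over `k`, viewed as a permutation group on the
embeddings of `K`. -/
def galPermHom (K : IntermediateField k kbar) :
    (kbar ≃ₐ[k] kbar) →* Equiv.Perm (K →ₐ[k] kbar) where
  toFun := galPerm k K
  map_one' := by
    refine Equiv.ext fun f => AlgHom.ext fun x => ?_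
    simp [galPerm]
  map_mul' σ τ := by
    refine Equiv.ext fun f => AlgHom.ext fun x => ?_
    simp [galPerm]

/-- `K` is an `S3`-cubic extension of `k`: it has degree `3` over `k` and the Galois group
of its Galois closure over `k` is the full symmetric group on the three embeddings of `K`
into `kbar`, i.e. the absolute Galois group of `k` surjects onto this symmetric group. -/
def IsSThreeCubic (K : IntermediateField k kbar) : Prop :=
  Module.finrank k K = 3 ∧ Function.Surjective (galPermHom k K)

/-- `Disc(K)`: the absolute norm to `ℚ` of the discriminant of `K/ℚ`
(junk value `0` if `K` is infinite-dimensional over `k`). -/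
def absDisc (K : IntermediateField k kbar) : ℕ :=
  haveI : CharZero K := (algebraMap K kbar).charZero
  if h : FiniteDimensional k K then
    haveI := h
    haveI : IsScalarTower ℚ k K := IsScalarTower.of_algebraMap_eq' (Subsingleton.elim _ _)
    haveI : FiniteDimensional ℚ K := Module.Finite.trans k K
    haveI : NumberField K := ⟨⟩
    (NumberField.discr K).natAbs
  else 0

/-- `K` is partially ramified at the prime `p` of `k`: `p 𝒪_K = P₁² P₂`
with `P₁ ≠ P₂` prime. -/
def PartiallyRamified (K : IntermediateField k kbar) (p : Ideal (𝓞 k)) : Prop :=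
  ∃ P₁ P₂ : Ideal (𝓞 K), P₁.IsPrime ∧ P₂.IsPrime ∧ P₁ ≠ P₂ ∧
    Ideal.map (algebraMap (𝓞 k) (𝓞 K)) p = P₁ ^ 2 * P₂

/-- `K` is totally ramified at the prime `p` of `k`: `p 𝒪_K = P³` with `P` prime. -/
def TotallyRamified (K : IntermediateField k kbar) (p : Ideal (𝓞 k)) : Prop :=
  ∃ P : Ideal (𝓞 K), P.IsPrime ∧
    Ideal.map (algebraMap (𝓞 k) (𝓞 K)) p = P ^ 3

/-- Two subfields of `kbar` are identified when they are isomorphic over `k`. -/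
def isoSetoid : Setoid (IntermediateField k kbar) where
  r K L := Nonempty (K ≃ₐ[k] L)
  iseqv := ⟨fun _ => ⟨AlgEquiv.refl⟩, fun ⟨e⟩ => ⟨e.symm⟩, fun ⟨e⟩ ⟨f⟩ => ⟨e.trans f⟩⟩

/-- The number of isomorphism classes of members of a given collection of extensions
of `k` inside `kbar`. -/
def countClasses (S : Set (IntermediateField k kbar)) : ℕ :=
  Nat.card (Quotient (Setoid.comap (Subtype.val : S → _) (isoSetoid k)))

/-- The relative `3`-class number `h3*(F/k) = #Cl(F)[3] / #Cl(k)[3]`, as a real number. -/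
def relThreeClassNumber (k : Type*) [Field k] [NumberField k]
    (F : IntermediateField k (AlgebraicClosure k)) : ℝ :=
  (Nat.card {x : ClassGroup (𝓞 F) // x ^ 3 = 1} : ℝ) /
    (Nat.card {x : ClassGroup (𝓞 k) // x ^ 3 = 1} : ℝ)

section Auxiliary

set_option linter.unusedSectionVars false

open NumberField InfinitePlace Module

open MeasureTheory Module in
theorem exists_ne_zero_mem_lattice_of_sublattice {E : Type*} [NormedAddCommGroup E]
    [NormedSpace ℝ E] [FiniteDimensional ℝ E] [MeasurableSpace E] [BorelSpace E]
    (μ : Measure E) [μ.IsAddHaarMeasure] (L : Submodule ℤ E) [DiscreteTopology L]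
    [IsZLattice ℝ L] (M : Submodule ℤ L)
    (hM : ∀ (a : ℤ) (x : L), a ≠ 0 → a • x ∈ M → x ∈ M) {l n : ℕ} (hl : l ≠ 0)
    (hn : finrank ℤ M ≤ n) {s : Set E} (hsymm : ∀ x ∈ s, -x ∈ s) (hconv : Convex ℝ s)
    (h : ENNReal.ofReal ((l : ℝ) ^ n * ZLattice.covolume L μ) * 2 ^ finrank ℝ E < μ s) :
    ∃ x : L, x ≠ 0 ∧ (x : E) ∈ s ∧ (x ∈ M → ∃ y ∈ M, x = l • y) := by
  have : Module.Finite ℤ L := ZLattice.module_finite ℝ L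
  have : Module.Free ℤ L := ZLattice.module_free ℝ L
  have : Module.IsTorsionFree ℤ (L ⧸ M) := by
    rw [Module.isTorsionFree_iff_smul_eq_zero]
    intro a x hx
    induction x using Submodule.Quotient.induction_on with
    | H x =>
      by_contra! hc
      rw [← Submodule.Quotient.mk_smul, Submodule.Quotient.mk_eq_zero] at hx
      exact hc.2 ((Submodule.Quotient.mk_eq_zero _).2 (hM a x hc.1 hx))
  have : Module.Free ℤ (L ⧸ M) := Module.free_of_finite_type_torsion_free'
  let bM := Module.finBasis ℤ M
  let bQ := Module.finBasis ℤ (L ⧸ M)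
  let b := Basis.sumQuot bM bQ
  let B := b.ofZLatticeBasis ℝ L
  let w : Fin (finrank ℤ M) ⊕ Fin (finrank ℤ (L ⧸ M)) → ℕ := Sum.elim (fun _ => l) (fun _ => 1)
  have hw : ∀ i, IsUnit (w i : ℝ) := by
    rintro (i | i) <;> simp [w, hl]
  let B' := B.isUnitSMul hw
  have hB' : ∀ i, B' i = (w i : ℝ) • (b i : E) := fun i => by
    rw [Basis.isUnitSMul_apply, Basis.ofZLatticeBasis_apply]
  have hcov : ZLattice.covolume L μ = μ.real (ZSpan.fundamentalDomain B) :=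
    ZLattice.covolume_eq_measure_fundamentalDomain L μ (ZLattice.isAddFundamentalDomain b μ)
  have hvol : μ (ZSpan.fundamentalDomain B') * 2 ^ finrank ℝ E < μ s := by
    refine lt_of_le_of_lt ?_ h
    gcongr
    rw [ZSpan.measure_fundamentalDomain _ μ B, hcov, Basis.det_isUnitSMul,
      ENNReal.ofReal_mul (by positivity), measureReal_def,
      ENNReal.ofReal_toReal (Bornology.IsBounded.measure_lt_top
        (ZSpan.fundamentalDomain_isBounded _)).ne]
    gcongr
    rw [Fintype.prod_sum_type]
    simp only [w, Sum.elim_inl, Sum.elim_inr, Finset.prod_const, Finset.card_univ,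
      Fintype.card_fin, Nat.cast_one, one_pow, mul_one, abs_pow, Nat.abs_cast]
    exact pow_le_pow_right₀ (by exact_mod_cast Nat.one_le_iff_ne_zero.2 hl) hn
  have : Countable (Submodule.span ℤ (Set.range B')).toAddSubgroup := by
    change Countable (Submodule.span ℤ (Set.range B'))
    infer_instance
  obtain ⟨⟨x, hx⟩, hx0, hxs⟩ := exists_ne_zero_mem_lattice_of_measure_mul_two_pow_lt_measure
    (ZSpan.isAddFundamentalDomain' B' μ) hsymm hconv hvol
  rw [Submodule.mem_toAddSubgroup, Submodule.mem_span_range_iff_exists_fun] at hx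
  obtain ⟨c, hc⟩ := hx
  let z : L := ∑ i, (c i * w i) • b i
  have hz : (z : E) = x := by
    rw [← hc]
    simp only [z, Submodule.coe_sum, Submodule.coe_smul, hB']
    refine Finset.sum_congr rfl fun i _ => ?_
    rw [mul_smul, natCast_zsmul, Nat.cast_smul_eq_nsmul]
  refine ⟨z, ?_, hz ▸ hxs, fun hzM => ?_⟩
  · rintro h0
    apply hx0
    simp [← hz, h0]
  · have hQ : ∀ i, c (Sum.inr i) = 0 := by
      have h1 : (Submodule.Quotient.mk z : L ⧸ M) = ∑ i, c (Sum.inr i) • bQ i := by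
        rw [← Submodule.mkQ_apply, map_sum, Fintype.sum_sum_type]
        have h2 : ∀ i, (c (Sum.inl i) * w (Sum.inl i)) • b (Sum.inl i) ∈ M := fun i => by
          refine M.smul_mem _ ?_
          simp only [b, Basis.sumQuot_inl]
          exact (bM i).2
        have h3 : ∀ i, M.mkQ ((c (Sum.inl i) * w (Sum.inl i)) • b (Sum.inl i)) = 0 := fun i => by
          rw [Submodule.mkQ_apply]; exact (Submodule.Quotient.mk_eq_zero _).2 (h2 i)
        simp only [h3, Finset.sum_const_zero, zero_add, w, Sum.elim_inr, Nat.cast_one, mul_one,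
          map_smul, Submodule.mkQ_apply]
        refine Finset.sum_congr rfl fun i _ => ?_
        simp only [b]
        rw [Basis.sumQuot_inr]
      rw [(Submodule.Quotient.mk_eq_zero _).2 hzM] at h1
      exact Fintype.linearIndependent_iff.1 bQ.linearIndependent _ h1.symm
    refine ⟨∑ i, c (Sum.inl i) • b (Sum.inl i), ?_, ?_⟩
    · refine M.sum_mem fun i _ => M.smul_mem _ ?_
      simp only [b, Basis.sumQuot_inl]
      exact (bM i).2
    · simp only [z, Fintype.sum_sum_type, hQ, w, Sum.elim_inl, zero_mul, zero_smul,
        Finset.sum_const_zero, add_zero, Finset.smul_sum]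
      refine Finset.sum_congr rfl fun i _ => ?_
      rw [mul_comm, mul_smul, natCast_zsmul]

open NumberField InfinitePlace mixedEmbedding Module nonZeroDivisors in
theorem exists_ne_zero_mem_ideal_lt_of_subspace {K : Type*} [Field K] [NumberField K]
    {I : Ideal (𝓞 K)} (hI : I ≠ ⊥) (V : Submodule ℚ K) {g : InfinitePlace K → ℝ}
    (hg : ∀ w, 0 < g w) (hgI : ∏ w, g w ^ mult w = Ideal.absNorm I) {l n : ℕ} (hl : l ≠ 0)
    (hn : finrank ℚ V ≤ n) {R : ℝ} (hR : 0 < R)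
    (h : (l : ℝ) ^ n * √|discr K| < R ^ finrank ℚ K) :
    ∃ a ∈ I, a ≠ 0 ∧ (∀ w : InfinitePlace K, w a < R * g w) ∧
      ((a : K) ∈ V → ∃ b ∈ I, (b : K) ∈ V ∧ a = l * b) := by
  let J : (FractionalIdeal (𝓞 K)⁰ K)ˣ := Units.mk0 (I : FractionalIdeal (𝓞 K)⁰ K) (by simpa)
  have hJ : ∀ y : K, y ∈ (J : Set K) ↔ ∃ a ∈ I, (a : K) = y := fun y => by
    simp [J, FractionalIdeal.mem_coeIdeal]
  let M : Submodule ℤ (idealLattice K J) :=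
    ((V.restrictScalars ℤ).map (mixedEmbedding K).toIntAlgHom.toLinearMap).comap
      (idealLattice K J).subtype
  have hMV : ∀ (x : idealLattice K J) (a : K), mixedEmbedding K a = x → (x ∈ M ↔ a ∈ V) := by
    intro x a hax
    simp only [M, Submodule.mem_comap, Submodule.subtype_apply, ← hax, Submodule.mem_map,
      Submodule.restrictScalars_mem]
    constructor
    · rintro ⟨b, hb, hab⟩
      rwa [← (mixedEmbedding_injective K) hab]
    · intro ha
      exact ⟨a, ha, rfl⟩
  have hM : ∀ (a : ℤ) (x : idealLattice K J), a ≠ 0 → a • x ∈ M → x ∈ M := by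
    rintro a ⟨x, hx⟩ ha hax
    obtain ⟨y, hy, hyx⟩ := (mem_idealLattice K J).1 hx
    rw [hMV _ (a • y) (by simp [← hyx])] at hax
    rw [hMV _ y hyx]
    have := V.smul_mem (a : ℚ)⁻¹ hax
    rwa [← Int.cast_smul_eq_zsmul ℚ, smul_smul, inv_mul_cancel₀ (by exact_mod_cast ha),
      one_smul] at this
  have hfin : finrank ℤ M ≤ n := by
    have : Module.Finite ℤ (idealLattice K J) := ZLattice.module_finite ℝ _
    have : Module.Free ℤ (idealLattice K J) := ZLattice.module_free ℝ _
    let bM := Module.finBasis ℤ M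
    have hf : ∀ i, ∃ y : V, mixedEmbedding K y = (bM i : idealLattice K J) := by
      intro i
      obtain ⟨y, hy, hyx⟩ := (mem_idealLattice K J).1 (bM i).1.2
      exact ⟨⟨y, (hMV _ y hyx).1 (bM i).2⟩, hyx⟩
    choose f hf using hf
    have hli : LinearIndependent ℤ f := by
      let φ : V →ₗ[ℤ] mixedSpace K :=
        (mixedEmbedding K).toIntAlgHom.toLinearMap ∘ₗ (V.restrictScalars ℤ).subtype
      apply LinearIndependent.of_comp φ
      have h1 : φ ∘ f = ((idealLattice K J).subtype ∘ₗ M.subtype) ∘ bM := by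
        ext1 i
        exact hf i
      rw [h1]
      exact bM.linearIndependent.map' _ (LinearMap.ker_eq_bot.2
        (Subtype.val_injective.comp Subtype.val_injective))
    rw [LinearIndependent.iff_fractionRing ℤ ℚ] at hli
    have := hli.fintype_card_le_finrank
    rw [Fintype.card_fin] at this
    exact this.trans hn
  let f : InfinitePlace K → NNReal := fun w => (R * g w).toNNReal
  have hf : ∀ w, (f w : ℝ) = R * g w := fun w =>
    Real.coe_toNNReal _ (mul_pos hR (hg w)).le
  have hNI : (0 : ℝ) < Ideal.absNorm I := by
    rw [← hgI]; exact Finset.prod_pos fun w _ => pow_pos (hg w) _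
  have hvol : ENNReal.ofReal ((l : ℝ) ^ n * ZLattice.covolume (idealLattice K J)) *
      2 ^ finrank ℝ (mixedSpace K) < MeasureTheory.volume (convexBodyLT K f) := by
    rw [convexBodyLT_volume, covolume_idealLattice]
    have h1 : (convexBodyLTFactor K : ENNReal) * ((∏ w, f w ^ mult w : NNReal) : ENNReal) =
        ENNReal.ofReal (2 ^ nrRealPlaces K * Real.pi ^ nrComplexPlaces K *
          (R ^ finrank ℚ K * Ideal.absNorm I)) := by
      rw [← ENNReal.coe_mul, ← ENNReal.ofReal_coe_nnreal]
      congr 1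
      simp only [convexBodyLTFactor, NNReal.coe_mul, NNReal.coe_pow, NNReal.coe_prod, hf,
        mul_pow, Finset.prod_mul_distrib, hgI, NNReal.coe_ofNat, NNReal.coe_real_pi]
      rw [Finset.prod_pow_eq_pow_sum, sum_mult_eq]
    have h2 : (2 : ENNReal) ^ finrank ℝ (mixedSpace K) =
        ENNReal.ofReal (2 ^ nrRealPlaces K * 4 ^ nrComplexPlaces K) := by
      rw [mixedEmbedding.finrank, ← card_add_two_mul_card_eq_rank, pow_add, pow_mul,
        ENNReal.ofReal_mul (by positivity), ENNReal.ofReal_pow (by norm_num),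
        ENNReal.ofReal_pow (by norm_num), ENNReal.ofReal_ofNat, ENNReal.ofReal_ofNat]
      norm_num
    simp only [J, Units.val_mk0, FractionalIdeal.coeIdeal_absNorm, Rat.cast_natCast]
    rw [h1, h2, ← ENNReal.ofReal_mul (by positivity), ENNReal.ofReal_lt_ofReal_iff (by positivity)]
    calc (l : ℝ) ^ n * (Ideal.absNorm I * 2⁻¹ ^ nrComplexPlaces K * √|discr K|) *
          (2 ^ nrRealPlaces K * 4 ^ nrComplexPlaces K)
        = (l ^ n * √|discr K|) * (2 ^ nrRealPlaces K * (2⁻¹ * 4) ^ nrComplexPlaces K *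
          Ideal.absNorm I) := by rw [mul_pow]; ring
      _ < R ^ finrank ℚ K * (2 ^ nrRealPlaces K * (2⁻¹ * 4) ^ nrComplexPlaces K *
          Ideal.absNorm I) := by gcongr
      _ ≤ R ^ finrank ℚ K * (2 ^ nrRealPlaces K * Real.pi ^ nrComplexPlaces K *
          Ideal.absNorm I) := by
          gcongr
          linarith [Real.two_le_pi]
      _ = _ := by ring
  obtain ⟨⟨x, hx⟩, hx0, hxs, hxM⟩ := exists_ne_zero_mem_lattice_of_sublattice
    MeasureTheory.volume (idealLattice K J) M hM hl hfin
    (convexBodyLT_neg_mem K f) (convexBodyLT_convex K f) hvol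
  obtain ⟨y, hy, rfl⟩ := (mem_idealLattice K J).1 hx
  obtain ⟨a, ha, rfl⟩ := (hJ y).1 hy
  refine ⟨a, ha, ?_, fun w => hf w ▸ (convexBodyLT_mem K f).1 hxs w, fun haV => ?_⟩
  · rintro rfl
    apply hx0
    simp
  · obtain ⟨⟨z, hz⟩, hzM, hxz⟩ := hxM ((hMV _ _ rfl).2 haV)
    obtain ⟨y, hy', rfl⟩ := (mem_idealLattice K J).1 hz
    obtain ⟨b, hb, rfl⟩ := (hJ y).1 hy'
    refine ⟨b, hb, (hMV _ _ rfl).1 hzM, ?_⟩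
    have h3 := congrArg Subtype.val hxz
    apply RingOfIntegers.ext
    apply mixedEmbedding_injective K
    refine h3.trans ?_
    simp [nsmul_eq_mul]

open NumberField InfinitePlace Module in
theorem exists_le_infinitePlace_of_mem {K : Type*} [Field K] [NumberField K]
    {I : Ideal (𝓞 K)} {g : InfinitePlace K → ℝ}
    (hgI : ∏ w, g w ^ mult w = Ideal.absNorm I) {a : 𝓞 K} (ha : a ∈ I) (ha0 : a ≠ 0) :
    ∃ w : InfinitePlace K, g w ≤ w a := by
  by_contra! hc
  have h1 : ∏ w : InfinitePlace K, w a ^ mult w < ∏ w, g w ^ mult w := by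
    refine Finset.prod_lt_prod_of_nonempty (fun w _ => pow_pos (w.pos_iff.2 (by simpa)) _)
      (fun w _ => pow_lt_pow_left₀ (hc w) (apply_nonneg _ _) mult_ne_zero) Finset.univ_nonempty
  rw [hgI, prod_eq_abs_norm, ← Algebra.coe_norm_int] at h1
  have h2 : (Ideal.absNorm I : ℤ) ∣ Algebra.norm ℤ a := Ideal.absNorm_dvd_norm_of_mem ha
  have h3 : (Ideal.absNorm I : ℤ) ≤ |Algebra.norm ℤ a| :=
    Int.le_of_dvd (abs_pos.2 (Algebra.norm_ne_zero_iff.2 ha0)) ((dvd_abs _ _).2 h2)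
  have h4 : ((Ideal.absNorm I : ℤ) : ℝ) ≤ ((|Algebra.norm ℤ a| : ℤ) : ℝ) := by exact_mod_cast h3
  push_cast at h1 h4
  linarith

open NumberField InfinitePlace Module in
theorem exists_two_short_vectors (k : Type*) {F : Type*} [Field k] [NumberField k] [Field F]
    [NumberField F] [Algebra k F] (h2 : finrank k F = 2) {I : Ideal (𝓞 F)} (hI : I ≠ ⊥)
    {g : InfinitePlace F → ℝ} (hg : ∀ w, 0 < g w)
    (hgI : ∏ w, g w ^ mult w = Ideal.absNorm I) {Y : ℝ} (hY : 0 < Y)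
    (hYD : Y ^ (2 * finrank ℚ k) = √|discr F|) :
    ∃ (j : ℕ) (α β : 𝓞 F), α ∈ I ∧ β ∈ I ∧ α ≠ 0 ∧ (∀ c : k, (β : F) ≠ c • (α : F)) ∧
      (∀ w : InfinitePlace F, w α < 2 * 2⁻¹ ^ j * Y * g w) ∧
      (∀ w : InfinitePlace F, w β < 4 * 2 ^ j * Y * g w) := by
  have hfr : finrank ℚ F = 2 * finrank ℚ k := by
    rw [← finrank_mul_finrank ℚ k F, h2, mul_comm]
  let P : ℕ → Prop := fun j => ∃ a ∈ I, a ≠ 0 ∧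
    ∀ w : InfinitePlace F, w a < 2 * 2⁻¹ ^ j * Y * g w
  have hn0 : finrank ℚ k ≠ 0 := finrank_pos.ne'
  have hP0 : P 0 := by
    obtain ⟨a, ha, ha0, hab, -⟩ := exists_ne_zero_mem_ideal_lt_of_subspace hI
      (⊥ : Submodule ℚ F) hg hgI one_ne_zero (n := 0) (by simp) (R := 2 * Y) (by positivity) (by
        rw [hfr, mul_pow, ← hYD]
        simp only [Nat.cast_one, pow_zero, one_mul]
        exact lt_mul_of_one_lt_left (by positivity) (one_lt_pow₀ (by norm_num) (by simpa)))
    exact ⟨a, ha, ha0, by simpa using hab⟩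
  have hP : ∃ j, ¬ P (j + 1) := by
    obtain ⟨j, hj⟩ := exists_pow_lt_of_lt_one (show (0 : ℝ) < (2 * Y)⁻¹ by positivity)
      (show (2⁻¹ : ℝ) < 1 by norm_num)
    refine ⟨j, ?_⟩
    rintro ⟨a, ha, ha0, hab⟩
    obtain ⟨w, hw⟩ := exists_le_infinitePlace_of_mem hgI ha ha0
    have h3 := hw.trans_lt (hab w)
    have h4 : 2 * 2⁻¹ ^ (j + 1) * Y ≤ (1 : ℝ) := by
      rw [lt_inv_comm₀ (by positivity) (by positivity)] at hj
      rw [pow_succ]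
      have : (2⁻¹ : ℝ) ^ j * ((2⁻¹ : ℝ) ^ j)⁻¹ = 1 := mul_inv_cancel₀ (by positivity)
      have h5 : (0 : ℝ) < 2⁻¹ ^ j := by positivity
      nlinarith
    nlinarith [hg w]
  obtain ⟨α, hα, hα0, hαb⟩ : P (Nat.find hP) := by
    by_cases h0 : Nat.find hP = 0
    · rwa [h0]
    · obtain ⟨m, hm⟩ := Nat.exists_eq_succ_of_ne_zero h0
      have := Nat.find_min hP (m := m) (by omega)
      rw [not_not] at this
      rwa [hm]
  have hnP := Nat.find_spec hP
  set j := Nat.find hP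
  let S : Submodule k F := Submodule.span k {(α : F)}
  have hS : finrank ℚ (S.restrictScalars ℚ) ≤ finrank ℚ k := by
    change finrank ℚ S ≤ _
    rw [← finrank_mul_finrank ℚ k S, finrank_span_singleton (by simpa), mul_one]
  obtain ⟨β, hβ, hβ0, hβb, hβS⟩ := exists_ne_zero_mem_ideal_lt_of_subspace hI
      (S.restrictScalars ℚ) hg hgI (l := 4 ^ (j + 1)) (by positivity) hS (R := 4 * 2 ^ j * Y)
      (by positivity) (by
        rw [hfr, mul_pow, ← hYD]
        gcongr
        rw [pow_mul]
        push_cast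
        apply pow_lt_pow_left₀ _ (by positivity) hn0
        rw [mul_pow, ← pow_mul, mul_comm j 2, pow_mul, pow_succ]
        norm_num
        have : (0 : ℝ) < 4 ^ j := by positivity
        linarith)
  refine ⟨j, α, β, hα, hβ, hα0, ?_, hαb, hβb⟩
  intro c hc
  obtain ⟨b, hb, -, hβb'⟩ := hβS (Submodule.mem_span_singleton.2 ⟨c, hc.symm⟩)
  apply hnP
  refine ⟨b, hb, ?_, fun w => ?_⟩
  · rintro rfl
    simp [hβb'] at hβ0
  · have h3 := hβb w
    rw [hβb'] at h3
    simp only [map_mul, Nat.cast_pow, Nat.cast_ofNat, map_pow] at h3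
    have h4 : w (4 : F) = 4 := by simpa using w.map_natCast 4
    rw [map_ofNat, h4] at h3
    have h5 : (4 : ℝ) ^ (j + 1) = 4 * (2 ^ j * 2 ^ j) := by
      rw [← mul_pow, pow_succ]; norm_num; ring
    have h6 : (2⁻¹ : ℝ) ^ (j + 1) * 2 * 2 ^ j = 1 := by
      rw [pow_succ, inv_pow]; field_simp
    have h7 : (0 : ℝ) < 2 ^ j := by positivity
    rw [h5] at h3
    have h8 : 2 ^ j * w (b : F) < Y * g w := by
      have : 0 < 4 * (2 : ℝ) ^ j := by positivity
      nlinarith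
    have h9 : 2 ^ j * w (b : F) < 2 ^ j * (2 * 2⁻¹ ^ (j + 1) * Y * g w) := by
      calc _ < Y * g w := h8
        _ = (2⁻¹ ^ (j + 1) * 2 * 2 ^ j) * (Y * g w) := by rw [h6, one_mul]
        _ = _ := by ring
    exact lt_of_mul_lt_mul_left h9 h7.le

section QuadConj

variable {k₀ F : Type*} [Field k₀] [NumberField k₀] [Field F] [NumberField F] [Algebra k₀ F]

/-- `σ` is the nontrivial automorphism of a quadratic extension. -/
structure IsQuadConj (σ : F ≃ₐ[k₀] F) : Prop where
  finrank_eq : Module.finrank k₀ F = 2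
  invol : ∀ x, σ (σ x) = x
  fixed : ∀ x, σ x = x → ∃ c : k₀, algebraMap k₀ F c = x

theorem exists_isQuadConj (h2 : Module.finrank k₀ F = 2) : ∃ σ : F ≃ₐ[k₀] F, IsQuadConj σ := by
  have : Algebra.IsQuadraticExtension k₀ F := ⟨h2⟩
  have hcard : Nat.card (F ≃ₐ[k₀] F) = 2 := (IsGalois.card_aut_eq_finrank k₀ F).trans h2
  obtain ⟨σ, τ, hστ, huniv⟩ := Nat.card_eq_two_iff.1 hcard
  wlog hσ : σ ≠ 1 generalizing σ τ
  · exact this τ σ hστ.symm (by rwa [Set.pair_comm]) (by rintro rfl; simp_all)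
  have h1 : ∀ φ : F ≃ₐ[k₀] F, φ = σ ∨ φ = 1 := by
    intro φ
    have h3 : φ ∈ ({σ, τ} : Set (F ≃ₐ[k₀] F)) := huniv ▸ Set.mem_univ φ
    have h4 : (1 : F ≃ₐ[k₀] F) ∈ ({σ, τ} : Set (F ≃ₐ[k₀] F)) := huniv ▸ Set.mem_univ _
    rcases h4 with h4 | h4
    · exact absurd h4.symm hσ
    · rw [Set.mem_singleton_iff] at h4
      rw [h4]
      exact h3
  refine ⟨σ, h2, fun x => ?_, fun x hx => ?_⟩
  · have hsq : σ * σ = 1 := by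
      rcases h1 (σ * σ) with h | h
      · exact absurd (mul_eq_left.1 h) hσ
      · exact h
    exact DFunLike.congr_fun hsq x
  · refine (IsGalois.mem_range_algebraMap_iff_fixed x).2 fun φ => ?_
    rcases h1 φ with rfl | rfl
    · exact hx
    · rfl

variable {σ : F ≃ₐ[k₀] F}

/-- The automorphism induced on the ring of integers. -/
def intConj (σ : F ≃ₐ[k₀] F) : 𝓞 F ≃+* 𝓞 F := NumberField.RingOfIntegers.mapRingEquiv σ.toRingEquiv

@[simp]
theorem coe_intConj (σ : F ≃ₐ[k₀] F) (x : 𝓞 F) : ((intConj σ x : 𝓞 F) : F) = σ x := rfl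

theorem IsQuadConj.intConj_intConj (hσ : IsQuadConj σ) (x : 𝓞 F) :
    intConj σ (intConj σ x) = x := by
  ext; simp [hσ.invol]

theorem IsQuadConj.exists_ringOfIntegers (hσ : IsQuadConj σ) {x : F} (hx : σ x = x)
    (hi : IsIntegral ℤ x) : ∃ c : 𝓞 k₀, algebraMap k₀ F c = x := by
  obtain ⟨c, rfl⟩ := hσ.fixed x hx
  exact ⟨⟨c, (isIntegral_algebraMap_iff (algebraMap k₀ F).injective).1 hi⟩, rfl⟩

open Polynomial in
theorem IsQuadConj.sub_mem_differentIdeal (hσ : IsQuadConj σ) (x : 𝓞 F) :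
    x - intConj σ x ∈ differentIdeal (𝓞 k₀) (𝓞 F) := by
  by_cases hx : σ (x : F) = x
  · have : intConj σ x = x := by ext; simpa using hx
    simp [this]
  have hdeg : (minpoly k₀ (x : F)).natDegree = 2 := by
    have h1 := minpoly.natDegree_le (A := k₀) (x : F)
    rw [hσ.finrank_eq] at h1
    have h2 := minpoly.natDegree_pos (IsIntegral.of_finite k₀ (x : F))
    have h3 : (minpoly k₀ (x : F)).natDegree ≠ 1 := by
      rw [Ne, minpoly.natDegree_eq_one_iff]
      rintro ⟨c, hc⟩
      apply hx
      rw [← hc, σ.commutes]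
    omega
  have hadj : Algebra.adjoin k₀ {(x : F)} = ⊤ := by
    have h4 := (Field.primitive_element_iff_minpoly_natDegree_eq k₀ (x : F)).2
      (hdeg.trans hσ.finrank_eq.symm)
    rw [← IntermediateField.adjoin_simple_toSubalgebra_of_isAlgebraic
      (Algebra.IsAlgebraic.isAlgebraic _), h4, IntermediateField.top_toSubalgebra]
  have key := aeval_derivative_mem_differentIdeal (𝓞 k₀) k₀ F x hadj
  convert key using 1
  apply NumberField.RingOfIntegers.ext
  have h5 : minpoly k₀ (x : F) = (minpoly (𝓞 k₀) x).map (algebraMap (𝓞 k₀) k₀) :=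
    minpoly.isIntegrallyClosed_eq_field_fractions k₀ F (Algebra.IsIntegral.isIntegral x)
  have h6 : ((aeval x (derivative (minpoly (𝓞 k₀) x)) : 𝓞 F) : F) =
      aeval (x : F) (derivative (minpoly k₀ (x : F))) := by
    rw [h5, derivative_map, aeval_map_algebraMap, aeval_algebraMap_apply]
  rw [h6]
  have h7 : ∀ y : F, aeval y (minpoly k₀ (x : F)) = y ^ 2 +
      algebraMap k₀ F ((minpoly k₀ (x : F)).coeff 1) * y +
      algebraMap k₀ F ((minpoly k₀ (x : F)).coeff 0) := by
    intro y
    have h8 : (minpoly k₀ (x : F)).coeff 2 = 1 := by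
      have := minpoly.monic (IsIntegral.of_finite k₀ (x : F))
      rwa [Monic, leadingCoeff, hdeg] at this
    rw [aeval_eq_sum_range, hdeg]
    simp [Finset.sum_range_succ, Algebra.smul_def, h8]
    ring
  have h9 : aeval (x : F) (derivative (minpoly k₀ (x : F))) = 2 * x +
      algebraMap k₀ F ((minpoly k₀ (x : F)).coeff 1) := by
    have h8 : (minpoly k₀ (x : F)).coeff 2 = 1 := by
      have := minpoly.monic (IsIntegral.of_finite k₀ (x : F))
      rwa [Monic, leadingCoeff, hdeg] at this
    rw [aeval_eq_sum_range' (n := 2) (by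
      have := natDegree_derivative_le (minpoly k₀ (x : F))
      omega)]
    simp [Finset.sum_range_succ, Algebra.smul_def, coeff_derivative, h8, one_add_one_eq_two]
    ring
  have h10 := h7 x
  rw [minpoly.aeval] at h10
  have h11 := h7 (σ x)
  rw [aeval_algHom_apply σ, minpoly.aeval, map_zero] at h11
  have h12 : ((x : F) - σ x) * (x + σ x + algebraMap k₀ F ((minpoly k₀ (x : F)).coeff 1)) = 0 := by
    linear_combination h11 - h10
  rcases mul_eq_zero.1 h12 with h | h
  · exact absurd (sub_eq_zero.1 h).symm hx
  · rw [h9]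
    simp only [map_sub, coe_intConj]
    linear_combination -h

end QuadConj

/-- A constant controlling the conjugate differences of integers in quadratic extensions. -/
def conjBound (k₀ : Type*) [Field k₀] [NumberField k₀] : ℝ :=
  16 ^ (2 * finrank ℚ k₀) * (discr k₀ : ℝ) ^ 2

section QuadConj

variable {k₀ F : Type*} [Field k₀] [NumberField k₀] [Field F] [NumberField F] [Algebra k₀ F]
variable {σ : F ≃ₐ[k₀] F}

theorem conjBound_pos (k₀ : Type*) [Field k₀] [NumberField k₀] : 0 < conjBound k₀ := by
  have : (discr k₀ : ℝ) ≠ 0 := by exact_mod_cast discr_ne_zero k₀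
  unfold conjBound
  positivity

theorem infinitePlace_add_le {K : Type*} [Field K] (w : InfinitePlace K) (x y : K) :
    w (x + y) ≤ w x + w y := by
  simp only [← w.norm_embedding_eq, map_add]
  exact norm_add_le _ _

theorem infinitePlace_sub_le {K : Type*} [Field K] (w : InfinitePlace K) (x y : K) :
    w (x - y) ≤ w x + w y := by
  simp only [← w.norm_embedding_eq, map_sub]
  exact norm_sub_le _ _

theorem IsQuadConj.finrank_rat (hσ : IsQuadConj σ) : finrank ℚ F = 2 * finrank ℚ k₀ := by
  rw [← finrank_mul_finrank ℚ k₀ F, hσ.finrank_eq, mul_comm]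

theorem IsQuadConj.exists_antiinvariant (hσ : IsQuadConj σ) {Y : ℝ} (hY : 0 < Y)
    (hYD : Y ^ (2 * finrank ℚ k₀) = √|discr F|) :
    ∃ r z : 𝓞 F, r ≠ 0 ∧ r = z - intConj σ z ∧ σ (r : F) = -r ∧
      ∀ w : InfinitePlace F, w r ≤ 16 * Y ^ 2 := by
  obtain ⟨j, α, β, -, -, hα0, hαβ, hα, hβ⟩ := exists_two_short_vectors k₀ hσ.finrank_eq
    (I := (⊤ : Ideal (𝓞 F))) (by simp) (g := fun _ => 1) (by simp) (by simp) hY hYD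
  refine ⟨α * intConj σ β - intConj σ α * β, α * intConj σ β, ?_, ?_, ?_, ?_⟩
  · intro h0
    have h1 : (α : F) * σ β - σ α * β = 0 := by
      simpa using congrArg (fun x : 𝓞 F => (x : F)) h0
    have hα0' : (α : F) ≠ 0 := by simpa
    have hσα0 : σ (α : F) ≠ 0 := by simpa
    obtain ⟨c, hc⟩ := hσ.fixed ((β : F) / α) (by
      rw [map_div₀, div_eq_div_iff hσα0 hα0']
      linear_combination h1)
    refine hαβ c ?_
    rw [Algebra.smul_def, hc, div_mul_cancel₀ _ hα0']
  · rw [map_mul, hσ.intConj_intConj]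
  · simp only [map_sub, map_mul, coe_intConj, hσ.invol]
    ring
  · intro w
    have h1 : w (σ (α : F)) ≤ 2 * 2⁻¹ ^ j * Y := by
      simpa using (hα (w.comap (σ : F →+* F))).le
    have h2 : w (σ (β : F)) ≤ 4 * 2 ^ j * Y := by
      simpa using (hβ (w.comap (σ : F →+* F))).le
    have h3 : w (α : F) ≤ 2 * 2⁻¹ ^ j * Y := by simpa using (hα w).le
    have h4 : w (β : F) ≤ 4 * 2 ^ j * Y := by simpa using (hβ w).le
    have h5 : (2⁻¹ : ℝ) ^ j * 2 ^ j = 1 := by rw [← mul_pow]; norm_num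
    calc w (α * intConj σ β - intConj σ α * β : 𝓞 F)
        = w ((α : F) * σ β - σ α * β) := by simp
      _ ≤ w ((α : F) * σ β) + w (σ α * β) := infinitePlace_sub_le _ _ _
      _ = w α * w (σ β) + w (σ α) * w β := by rw [map_mul, map_mul]
      _ ≤ (2 * 2⁻¹ ^ j * Y) * (4 * 2 ^ j * Y) + (2 * 2⁻¹ ^ j * Y) * (4 * 2 ^ j * Y) := by
          gcongr
      _ = 16 * (2⁻¹ ^ j * 2 ^ j) * Y ^ 2 := by ring
      _ = _ := by rw [h5, mul_one]

theorem IsQuadConj.exists_trace_twist (hσ : IsQuadConj σ) {Y : ℝ} (hY : 0 < Y)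
    (hYD : Y ^ (2 * finrank ℚ k₀) = √|discr F|) :
    ∃ τ : F, τ ≠ 0 ∧ σ τ = -τ ∧
      (∀ w : InfinitePlace F, w τ ≤ conjBound k₀ ^ 2 / (16 * Y ^ 2)) ∧
      ∀ x : 𝓞 F, ∃ c : 𝓞 k₀, algebraMap k₀ F c = τ * (x - σ x) := by
  obtain ⟨r, z, hr0, hrz, hσr, hr⟩ := hσ.exists_antiinvariant hY hYD
  set 𝔇 := differentIdeal (𝓞 k₀) (𝓞 F)
  have hr𝔇 : r ∈ 𝔇 := hrz ▸ hσ.sub_mem_differentIdeal z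
  obtain ⟨𝔢, h𝔢⟩ := Ideal.dvd_span_singleton.2 hr𝔇
  have hdisc : (Ideal.absNorm 𝔇 : ℝ) * (discr k₀ : ℝ) ^ 2 = |(discr F : ℝ)| := by
    have := natAbs_discr_eq_absNorm_differentIdeal_mul_natAbs_discr_pow k₀ (𝓞 k₀) F (𝓞 F)
    rw [hσ.finrank_eq] at this
    have h2 : ((discr F).natAbs : ℝ) = Ideal.absNorm 𝔇 * (discr k₀).natAbs ^ 2 := by
      exact_mod_cast this
    simpa [Nat.cast_natAbs] using h2.symm
  have hnorm : ∏ w : InfinitePlace F, w r ^ mult w = Ideal.absNorm 𝔇 * Ideal.absNorm 𝔢 := by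
    rw [prod_eq_abs_norm, ← Algebra.coe_norm_int, ← Nat.cast_mul, ← map_mul, ← h𝔢,
      Ideal.absNorm_span_singleton]
    simp [Nat.cast_natAbs]
  have hD : (16 * Y ^ 2) ^ (2 * finrank ℚ k₀) = 16 ^ (2 * finrank ℚ k₀) * |(discr F : ℝ)| := by
    have h1 : (Y ^ 2) ^ (2 * finrank ℚ k₀) = (Y ^ (2 * finrank ℚ k₀)) ^ 2 := by
      rw [← pow_mul, ← pow_mul, mul_comm]
    rw [mul_pow, h1, hYD, Real.sq_sqrt (by positivity)]
  have hDpos : 0 < |(discr F : ℝ)| := by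
    have : (discr F : ℝ) ≠ 0 := by exact_mod_cast discr_ne_zero F
    positivity
  have h𝔢0 : 0 < Ideal.absNorm 𝔢 := by
    rw [Nat.pos_iff_ne_zero, Ne, Ideal.absNorm_eq_zero_iff]
    rintro rfl
    simp [hr0] at h𝔢
  have hB : ∀ S : ℝ, S = (Ideal.absNorm 𝔇 : ℝ) → 0 < S := by
    rintro S rfl
    by_contra! h
    have : (discr k₀ : ℝ) ≠ 0 := by exact_mod_cast discr_ne_zero k₀
    have : 0 < (discr k₀ : ℝ) ^ 2 := by positivity
    nlinarith
  have h𝔇0 := hB _ rfl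
  have h𝔢B : (Ideal.absNorm 𝔢 : ℝ) ≤ conjBound k₀ := by
    have h1 : ∏ w : InfinitePlace F, w r ^ mult w ≤ (16 * Y ^ 2) ^ (2 * finrank ℚ k₀) := by
      rw [← hσ.finrank_rat, ← sum_mult_eq, ← Finset.prod_pow_eq_pow_sum]
      exact Finset.prod_le_prod (fun w _ => by positivity)
        fun w _ => pow_le_pow_left₀ (apply_nonneg _ _) (hr w) _
    rw [hnorm, hD, ← hdisc] at h1
    unfold conjBound
    refine le_of_mul_le_mul_left ?_ h𝔇0
    linarith
  have hlow : ∀ w : InfinitePlace F, 16 * Y ^ 2 ≤ conjBound k₀ * w r := by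
    intro w
    have ht : ∀ v : InfinitePlace F, v r / (16 * Y ^ 2) ≤ 1 := fun v => by
      rw [div_le_one (by positivity)]; exact hr v
    have h1 : ∏ v : InfinitePlace F, (v r / (16 * Y ^ 2)) ^ mult v ≤ w r / (16 * Y ^ 2) := by
      rw [← Finset.mul_prod_erase _ _ (Finset.mem_univ w)]
      calc _ ≤ (w r / (16 * Y ^ 2)) ^ mult w * 1 := by
            gcongr
            exact Finset.prod_le_one (fun v _ => by positivity)
              fun v _ => pow_le_one₀ (by positivity) (ht v)
        _ ≤ _ := by
            rw [mul_one]
            exact pow_le_of_le_one (by positivity) (ht w) mult_ne_zero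
    simp only [div_pow] at h1
    rw [Finset.prod_div_distrib, Finset.prod_pow_eq_pow_sum, sum_mult_eq, hσ.finrank_rat, hnorm,
      hD, ← hdisc, div_le_div_iff₀ (by rw [hdisc]; positivity) (by positivity)] at h1
    have h2 : (1 : ℝ) ≤ Ideal.absNorm 𝔢 := by exact_mod_cast h𝔢0
    unfold conjBound
    refine le_of_mul_le_mul_left ?_ h𝔇0
    calc (Ideal.absNorm 𝔇 : ℝ) * (16 * Y ^ 2)
        = Ideal.absNorm 𝔇 * 1 * (16 * Y ^ 2) := by ring
      _ ≤ Ideal.absNorm 𝔇 * Ideal.absNorm 𝔢 * (16 * Y ^ 2) := by gcongr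
      _ ≤ _ := h1
      _ = _ := by ring
  have hr0' : (r : F) ≠ 0 := by simpa
  refine ⟨(Ideal.absNorm 𝔢 : F) / r, ?_, ?_, ?_, ?_⟩
  · exact div_ne_zero (by exact_mod_cast h𝔢0.ne') hr0'
  · rw [map_div₀, hσr, map_natCast, div_neg]
  · intro w
    have hw : 0 < w r := w.pos_iff.2 hr0'
    rw [map_div₀, InfinitePlace.map_natCast, div_le_div_iff₀ hw (by positivity)]
    calc _ ≤ conjBound k₀ * (conjBound k₀ * w r) :=
          mul_le_mul h𝔢B (hlow w) (by positivity) (conjBound_pos k₀).le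
      _ = _ := by ring
  · intro x
    have h1 : (Ideal.absNorm 𝔢 : 𝓞 F) * (x - intConj σ x) ∈ Ideal.span {r} := by
      rw [h𝔢, mul_comm 𝔇]
      exact Ideal.mul_mem_mul (Ideal.absNorm_mem 𝔢) (hσ.sub_mem_differentIdeal x)
    obtain ⟨y, hy⟩ := Ideal.mem_span_singleton.1 h1
    have hy' : (Ideal.absNorm 𝔢 : F) * (x - σ x) = r * y := by
      simpa using congrArg (fun x : 𝓞 F => (x : F)) hy
    have h2 : (Ideal.absNorm 𝔢 : F) / r * (x - σ x) = y := by
      rw [div_mul_eq_mul_div, hy', mul_div_cancel_left₀ _ hr0']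
    obtain ⟨c, hc⟩ := hσ.exists_ringOfIntegers (x := (y : F)) (by
      rw [← h2]
      simp only [map_mul, map_div₀, map_sub, map_natCast, hσr, hσ.invol]
      rw [div_neg]
      ring) (RingOfIntegers.isIntegral_coe y)
    exact ⟨c, hc.trans h2.symm⟩
end QuadConj

theorem Ideal.eq_of_pow_eq_pow {R : Type*} [CommRing R] [IsDedekindDomain R] {I J : Ideal R}
    {n : ℕ} (hn : n ≠ 0) (h : I ^ n = J ^ n) : I = J :=
  dvd_antisymm ((UniqueFactorizationMonoid.pow_dvd_pow_iff_dvd hn).1 h.dvd)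
    ((UniqueFactorizationMonoid.pow_dvd_pow_iff_dvd hn).1 h.symm.dvd)

theorem Ideal.exists_eq_pow_three {R : Type*} [CommRing R] [IsDedekindDomain R] {I J : Ideal R}
    (h : I ^ 2 = J ^ 3) : ∃ L : Ideal R, I = L ^ 3 := by
  by_cases hJ : J = 0
  · rw [hJ, zero_pow three_ne_zero] at h
    exact ⟨0, by rw [zero_pow three_ne_zero, eq_zero_of_pow_eq_zero h]⟩
  obtain ⟨L, rfl⟩ := (UniqueFactorizationMonoid.pow_dvd_pow_iff_dvd two_ne_zero).1
    (⟨J, by rw [h, pow_succ]⟩ : J ^ 2 ∣ I ^ 2)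
  refine ⟨L, ?_⟩
  have h2 : L ^ 2 = J := by
    apply mul_left_cancel₀ (pow_ne_zero 2 hJ)
    rw [← mul_pow, h, pow_succ]
  rw [← h2]
  ring

section QuadConj

variable {k₀ F : Type*} [Field k₀] [NumberField k₀] [Field F] [NumberField F] [Algebra k₀ F]
variable {σ : F ≃ₐ[k₀] F}

theorem IsQuadConj.sub_mem_of_ramified (hσ : IsQuadConj σ) {p : Ideal (𝓞 k₀)} (hp : p.IsPrime)
    (hp0 : p ≠ ⊥) {P : Ideal (𝓞 F)} (hpP : p.map (algebraMap (𝓞 k₀) (𝓞 F)) = P ^ 2) (x : 𝓞 F) :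
    x - intConj σ x ∈ P := by
  have := hp.isMaximal hp0
  have h := pow_sub_one_dvd_differentIdeal (𝓞 k₀) (p := p) P 2 hp0 hpP.symm.dvd
  rw [show 2 - 1 = 1 from rfl, pow_one] at h
  exact Ideal.le_of_dvd h (hσ.sub_mem_differentIdeal x)

theorem mem_of_algebraMap_mem_of_ramified {p : Ideal (𝓞 k₀)} (hp : p.IsPrime)
    (hp0 : p ≠ ⊥) {P : Ideal (𝓞 F)} (hP : P.IsPrime)
    (hpP : p.map (algebraMap (𝓞 k₀) (𝓞 F)) = P ^ 2) {c : 𝓞 k₀}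
    (hc : algebraMap (𝓞 k₀) (𝓞 F) c ∈ P) : c ∈ p := by
  have h1 : p ≤ P.comap (algebraMap (𝓞 k₀) (𝓞 F)) := by
    rw [← Ideal.map_le_iff_le_comap, hpP]
    exact Ideal.pow_le_self two_ne_zero
  have h2 := (hp.isMaximal hp0).eq_of_le (Ideal.IsPrime.ne_top (Ideal.comap_isPrime _ _)) h1
  rw [h2]
  exact hc

theorem mk0_mem_range_of_pow_three_eq {J : Ideal (𝓞 F)} (hJ : J ∈ nonZeroDivisors (Ideal (𝓞 F)))
    (h2 : finrank k₀ F = 2) {a : 𝓞 k₀}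
    (h : J ^ 3 = Ideal.span {algebraMap (𝓞 k₀) (𝓞 F) a}) :
    ClassGroup.mk0 ⟨J, hJ⟩ ∈ (ClassGroup.extendedHom (𝓞 k₀) (𝓞 F)).range := by
  have h3 : Ideal.span {algebraMap (𝓞 k₀) (𝓞 F) a} =
      (Ideal.span {a}).map (algebraMap (𝓞 k₀) (𝓞 F)) := by
    rw [Ideal.map_span, Set.image_singleton]
  have hr : finrank (𝓞 k₀) (𝓞 F) = 2 := by
    rw [← h2]
    exact (IsFractionRing.finrank_eq (𝓞 k₀) k₀ (𝓞 F) F).symm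
  have h4 : (Ideal.span {a}) ^ 2 = Ideal.relNorm (𝓞 k₀) J ^ 3 := by
    rw [← map_pow, h, h3, Ideal.relNorm_algebraMap, hr]
  obtain ⟨L, hL⟩ := Ideal.exists_eq_pow_three h4
  have h5 : J = L.map (algebraMap (𝓞 k₀) (𝓞 F)) :=
    Ideal.eq_of_pow_eq_pow three_ne_zero (by rw [h, h3, hL, Ideal.map_pow])
  have hL0 : L ∈ nonZeroDivisors (Ideal (𝓞 k₀)) := by
    rw [mem_nonZeroDivisors_iff_ne_zero] at hJ ⊢
    rintro rfl
    exact hJ (by rw [h5]; simp)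
  refine ⟨ClassGroup.mk0 ⟨L, hL0⟩, ?_⟩
  rw [ClassGroup.extendedHom_mk0]
  congr 1
  exact Subtype.ext h5.symm

theorem exists_scaling_notMem {I P : Ideal (𝓞 F)} (hI : I ≠ ⊥) (hP : P.IsPrime) {δ : 𝓞 F}
    (hδ : I ^ 3 = Ideal.span {δ}) :
    ∃ ρ : F, (∀ y ∈ I, ∃ y' : 𝓞 F, (y' : F) = ρ * y) ∧
      ∃ g : 𝓞 F, g ∉ P ∧ (g : F) = ρ ^ 3 * δ := by
  have hlt : ¬ I ≤ I * P := by
    intro h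
    have : I * P = I := le_antisymm Ideal.mul_le_left h
    exact hP.ne_top (by simpa using mul_left_cancel₀ hI (this.trans (mul_one I).symm))
  obtain ⟨ρ₀, hρI, hρP⟩ := SetLike.not_le_iff_exists.1 hlt
  have hρ0 : ρ₀ ≠ 0 := by rintro rfl; exact hρP (zero_mem _)
  have hρ0' : (ρ₀ : F) ≠ 0 := by simpa
  obtain ⟨H, hH⟩ := Ideal.dvd_span_singleton.2 hρI
  have hHP : ¬ H ≤ P := by
    intro h
    apply hρP
    rw [← Ideal.span_singleton_le_iff_mem, hH]
    exact Ideal.mul_mono_right h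
  obtain ⟨h, hhH, hhP⟩ := SetLike.not_le_iff_exists.1 hHP
  refine ⟨h / ρ₀, fun y hy => ?_, ?_⟩
  · have h1 : y * h ∈ Ideal.span {ρ₀} := hH ▸ Ideal.mul_mem_mul hy hhH
    obtain ⟨y', hy'⟩ := Ideal.mem_span_singleton.1 h1
    refine ⟨y', ?_⟩
    have := congrArg (fun t : 𝓞 F => (t : F)) hy'
    simp only [map_mul] at this
    field_simp
    linear_combination -this
  · have h1 : δ * h ^ 3 ∈ Ideal.span {ρ₀ ^ 3} := by
      rw [← Ideal.span_singleton_pow, hH, mul_pow]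
      exact Ideal.mul_mem_mul (hδ ▸ Ideal.mem_span_singleton_self δ) (Ideal.pow_mem_pow hhH 3)
    obtain ⟨g, hg⟩ := Ideal.mem_span_singleton.1 h1
    refine ⟨g, fun hgP => hhP ?_, ?_⟩
    · have h2 : Ideal.span {g} * H ^ 3 = Ideal.span {h} ^ 3 := by
        have hI3 : I ^ 3 ≠ 0 := pow_ne_zero 3 hI
        apply mul_left_cancel₀ hI3
        calc I ^ 3 * (Ideal.span {g} * H ^ 3) = Ideal.span {g} * (I * H) ^ 3 := by ring
          _ = Ideal.span {ρ₀ ^ 3 * g} := by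
            rw [← hH, Ideal.span_singleton_pow, Ideal.span_singleton_mul_span_singleton, mul_comm]
          _ = _ := by
            rw [← hg, hδ, Ideal.span_singleton_pow, Ideal.span_singleton_mul_span_singleton]
      have h3 : h ^ 3 ∈ P := by
        rw [← Ideal.span_singleton_le_iff_mem, ← Ideal.span_singleton_pow, ← h2]
        exact Ideal.mul_le_left.trans ((Ideal.span_singleton_le_iff_mem _).2 hgP)
      exact hP.mem_of_pow_mem _ h3
    · have := congrArg (fun t : 𝓞 F => (t : F)) hg
      simp only [map_mul, map_pow] at this
      field_simp
      linear_combination -this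

end QuadConj

/-- The discriminant (up to a factor `-27`) of the binary cubic form
`b x³ + 3 c x² y + 3 d x y² + e y³`. -/
def cubicDisc {R : Type*} [CommRing R] (b c d e : R) : R :=
  b ^ 2 * e ^ 2 - 6 * b * c * d * e + 4 * b * d ^ 3 + 4 * c ^ 3 * e - 3 * c ^ 2 * d ^ 2

section QuadConj

variable {k₀ F : Type*} [Field k₀] [NumberField k₀] [Field F] [NumberField F] [Algebra k₀ F]
variable {σ : F ≃ₐ[k₀] F} {τ : F}

/-- The integral binary cubic form `b x³ + 3 c x² y + 3 d x y² + e y³` is the twisted trace of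
`(α x + β y)³ / δ`. -/
structure IsTwistedForm (σ : F ≃ₐ[k₀] F) (τ δ α β : F) (b c d e : 𝓞 k₀) : Prop where
  fst : algebraMap k₀ F b = τ * (α ^ 3 / δ - σ (α ^ 3 / δ))
  snd : algebraMap k₀ F c = τ * (α ^ 2 * β / δ - σ (α ^ 2 * β / δ))
  trd : algebraMap k₀ F d = τ * (α * β ^ 2 / δ - σ (α * β ^ 2 / δ))
  fth : algebraMap k₀ F e = τ * (β ^ 3 / δ - σ (β ^ 3 / δ))

/-- The cubic form `b x³ + 3 c x² y + 3 d x y² + e y³`, with a chosen square root `s` of its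
discriminant, represents the ideal class `x`. -/
structure IsFormDatum (τ : F) (x : ClassGroup (𝓞 F)) (b c d e : 𝓞 k₀) (s : F) : Prop where
  sq_eq : s ^ 2 = algebraMap k₀ F (cubicDisc b c d e : 𝓞 k₀)
  notMem : ∀ a : k₀, algebraMap k₀ F a ≠ s
  exists_ideal : ∃ (A : 𝓞 F) (J : Ideal (𝓞 F)) (hJ : J ∈ nonZeroDivisors (Ideal (𝓞 F))),
    2 * s * τ * A = s * algebraMap k₀ F b -
      algebraMap k₀ F (b ^ 2 * e - 3 * b * c * d + 2 * c ^ 3 : 𝓞 k₀) ∧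
    J ^ 3 = Ideal.span {A} ∧ ClassGroup.mk0 ⟨J, hJ⟩ = x⁻¹

theorem IsFormDatum.unique (hτ : τ ≠ 0) {x y : ClassGroup (𝓞 F)} {b c d e : 𝓞 k₀} {s : F}
    (h₁ : IsFormDatum τ x b c d e s) (h₂ : IsFormDatum τ y b c d e s) : x = y := by
  obtain ⟨A, J, hJ, h1, h2, h3⟩ := h₁.exists_ideal
  obtain ⟨A', J', hJ', h1', h2', h3'⟩ := h₂.exists_ideal
  have hs : s ≠ 0 := fun h => h₁.notMem 0 (by rw [h, map_zero])
  have hA : A = A' := by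
    apply RingOfIntegers.ext
    exact mul_left_cancel₀ (mul_ne_zero (mul_ne_zero two_ne_zero hs) hτ) (h1.trans h1'.symm)
  have hJJ : J = J' := Ideal.eq_of_pow_eq_pow three_ne_zero (by rw [h2, h2', hA])
  subst hJJ
  exact inv_injective (h3.symm.trans h3')

theorem exists_isTwistedForm (hτ : ∀ x : 𝓞 F, ∃ c : 𝓞 k₀, algebraMap k₀ F c = τ * (x - σ x))
    {I : Ideal (𝓞 F)} {δ α β : 𝓞 F} (hδ0 : δ ≠ 0) (hδ : I ^ 3 = Ideal.span {δ}) (hα : α ∈ I)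
    (hβ : β ∈ I) : ∃ b c d e : 𝓞 k₀, IsTwistedForm σ τ (δ : F) α β b c d e := by
  have key : ∀ y ∈ I ^ 3, ∃ c : 𝓞 k₀, algebraMap k₀ F c = τ * ((y : F) / δ - σ (y / δ)) := by
    intro y hy
    rw [hδ] at hy
    obtain ⟨t, rfl⟩ := Ideal.mem_span_singleton.1 hy
    obtain ⟨c, hc⟩ := hτ t
    refine ⟨c, ?_⟩
    have : ((δ * t : 𝓞 F) : F) / δ = t := by
      have hδ0' : (δ : F) ≠ 0 := by simpa
      change (δ : F) * t / δ = t
      rw [mul_div_cancel_left₀ _ hδ0']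
    rw [this, hc]
  have hm : ∀ x ∈ I, ∀ y ∈ I, ∀ z ∈ I, x * y * z ∈ I ^ 3 := fun x hx y hy z hz => by
    rw [pow_succ, pow_two]
    exact Ideal.mul_mem_mul (Ideal.mul_mem_mul hx hy) hz
  obtain ⟨b, hb⟩ := key _ (hm _ hα _ hα _ hα)
  obtain ⟨c, hc⟩ := key _ (hm _ hα _ hα _ hβ)
  obtain ⟨d, hd⟩ := key _ (hm _ hα _ hβ _ hβ)
  obtain ⟨e, he⟩ := key _ (hm _ hβ _ hβ _ hβ)
  refine ⟨b, c, d, e, ?_, ?_, ?_, ?_⟩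
  · rw [hb]; simp only [map_mul]; ring_nf
  · rw [hc]; simp only [map_mul]; ring_nf
  · rw [hd]; simp only [map_mul]; ring_nf
  · rw [he]; simp only [map_mul]; ring_nf

theorem IsTwistedForm.add_mul {δ α β : F} {b c d e : 𝓞 k₀} (h : IsTwistedForm σ τ δ α β b c d e)
    (u : 𝓞 k₀) : IsTwistedForm σ τ δ α (β + algebraMap k₀ F u * α) b (c + b * u)
      (d + 2 * c * u + b * u ^ 2) (e + 3 * d * u + 3 * c * u ^ 2 + b * u ^ 3) := by
  obtain ⟨h1, h2, h3, h4⟩ := h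
  simp only [map_div₀, map_mul, map_pow] at h1 h2 h3 h4
  constructor <;>
    simp only [map_div₀, map_mul, map_pow, map_add, σ.commutes, h1, h2, h3, h4, map_ofNat] <;> ring

/-- The canonical square root of the discriminant of a twisted form. -/
def sqrtDisc (σ : F ≃ₐ[k₀] F) (τ δ α β : F) : F :=
  τ ^ 2 * (α * σ β - σ α * β) ^ 3 / (δ * σ δ)

theorem IsTwistedForm.sq_sqrtDisc {δ α β : F} {b c d e : 𝓞 k₀}
    (h : IsTwistedForm σ τ δ α β b c d e) (hδ : δ ≠ 0) :
    sqrtDisc σ τ δ α β ^ 2 = algebraMap k₀ F (cubicDisc b c d e : 𝓞 k₀) := by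
  obtain ⟨h1, h2, h3, h4⟩ := h
  have hσ : σ δ ≠ 0 := by simpa
  simp only [map_div₀, map_mul, map_pow] at h1 h2 h3 h4
  simp only [cubicDisc, sqrtDisc, map_mul, map_pow, map_add, map_sub, h1, h2, h3, h4,
    map_ofNat]
  field_simp
  ring

theorem IsTwistedForm.two_mul_sqrtDisc_mul {δ α β : F} {b c d e : 𝓞 k₀}
    (h : IsTwistedForm σ τ δ α β b c d e) (hδ : δ ≠ 0) :
    2 * sqrtDisc σ τ δ α β * τ * (α ^ 3 / δ) = sqrtDisc σ τ δ α β * algebraMap k₀ F b -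
      algebraMap k₀ F (b ^ 2 * e - 3 * b * c * d + 2 * c ^ 3 : 𝓞 k₀) := by
  obtain ⟨h1, h2, h3, h4⟩ := h
  have hσ : σ δ ≠ 0 := by simpa
  simp only [map_div₀, map_mul, map_pow] at h1 h2 h3 h4
  simp only [sqrtDisc, map_mul, map_pow, map_add, map_sub, h1, h2, h3, h4,
    map_ofNat]
  field_simp
  ring

end QuadConj

section QuadConj

variable {k₀ F : Type*} [Field k₀] [NumberField k₀] [Field F] [NumberField F] [Algebra k₀ F]
variable {σ : F ≃ₐ[k₀] F} {τ : F}

theorem IsQuadConj.wronskian_ne_zero (hσ : IsQuadConj σ) {α β : F} (hα : α ≠ 0)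
    (hβ : ∀ c : k₀, β ≠ c • α) : α * σ β - σ α * β ≠ 0 := by
  intro h1
  have hσα0 : σ α ≠ 0 := by simpa
  obtain ⟨c, hc⟩ := hσ.fixed (β / α) (by
    rw [map_div₀, div_eq_div_iff hσα0 hα]
    linear_combination h1)
  refine hβ c ?_
  rw [Algebra.smul_def, hc, div_mul_cancel₀ _ hα]

theorem IsQuadConj.notMem_of_apply_eq_neg {s : F} (hs : σ s = -s) (hs0 : s ≠ 0) (a : k₀) :
    algebraMap k₀ F a ≠ s := by
  rintro rfl
  rw [σ.commutes, eq_neg_iff_add_eq_zero, ← two_mul] at hs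
  exact hs0 ((mul_eq_zero.1 hs).resolve_left two_ne_zero)

theorem apply_sqrtDisc (hσ : IsQuadConj σ) (hτ : σ τ = -τ) (δ α β : F) :
    σ (sqrtDisc σ τ δ α β) = -sqrtDisc σ τ δ α β := by
  simp only [sqrtDisc, map_div₀, map_mul, map_pow, map_sub, hσ.invol, hτ]
  rw [mul_comm (σ δ) δ, ← neg_div]
  congr 1
  ring

theorem exists_span_pow_three_eq {I : Ideal (𝓞 F)} (hI : I ∈ nonZeroDivisors (Ideal (𝓞 F)))
    {δ α : 𝓞 F} (hδ0 : δ ≠ 0) (hδ : I ^ 3 = Ideal.span {δ}) (hα : α ∈ I) (hα0 : α ≠ 0) :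
    ∃ (A : 𝓞 F) (J : Ideal (𝓞 F)) (hJ : J ∈ nonZeroDivisors (Ideal (𝓞 F))),
      (A : F) = (α : F) ^ 3 / δ ∧ J ^ 3 = Ideal.span {A} ∧
        ClassGroup.mk0 ⟨J, hJ⟩ = (ClassGroup.mk0 ⟨I, hI⟩)⁻¹ := by
  have h1 : α ^ 3 ∈ Ideal.span {δ} := hδ ▸ Ideal.pow_mem_pow hα 3
  obtain ⟨A, hA⟩ := Ideal.mem_span_singleton.1 h1
  obtain ⟨J, hJ⟩ := Ideal.dvd_span_singleton.2 hα
  have hJ0 : J ∈ nonZeroDivisors (Ideal (𝓞 F)) := by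
    rw [mem_nonZeroDivisors_iff_ne_zero]
    rintro rfl
    simp [hα0] at hJ
  refine ⟨A, J, hJ0, ?_, ?_, ?_⟩
  · have h2 : (α : F) ^ 3 = δ * A := congrArg (fun t : 𝓞 F => (t : F)) hA
    have hδ0' : (δ : F) ≠ 0 := by simpa
    rw [h2, mul_div_cancel_left₀ _ hδ0']
  · have hI3 : I ^ 3 ≠ 0 := pow_ne_zero 3 (mem_nonZeroDivisors_iff_ne_zero.1 hI)
    apply mul_left_cancel₀ hI3
    rw [← mul_pow, ← hJ, hδ, Ideal.span_singleton_pow, Ideal.span_singleton_mul_span_singleton, hA]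
  · rw [eq_inv_iff_mul_eq_one, ← map_mul]
    refine (ClassGroup.mk0_eq_one_iff _).2 ⟨α, ?_⟩
    change J * I = _
    rw [mul_comm, ← hJ]

theorem IsTwistedForm.isFormDatum (hσ : IsQuadConj σ) (hτ0 : τ ≠ 0) (hτ : σ τ = -τ)
    {I : Ideal (𝓞 F)} (hI : I ∈ nonZeroDivisors (Ideal (𝓞 F))) {δ α β : 𝓞 F} (hδ0 : δ ≠ 0)
    (hδ : I ^ 3 = Ideal.span {δ}) (hα : α ∈ I) (hα0 : α ≠ 0) (hβ : ∀ c : k₀, (β : F) ≠ c • (α : F))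
    {b c d e : 𝓞 k₀} (h : IsTwistedForm σ τ (δ : F) α β b c d e) :
    IsFormDatum τ (ClassGroup.mk0 ⟨I, hI⟩) b c d e (sqrtDisc σ τ (δ : F) α β) := by
  have hα0' : (α : F) ≠ 0 := by simpa
  have hδ0' : (δ : F) ≠ 0 := by simpa
  have hσδ : σ (δ : F) ≠ 0 := by simpa
  refine ⟨h.sq_sqrtDisc hδ0', ?_, ?_⟩
  · refine IsQuadConj.notMem_of_apply_eq_neg (apply_sqrtDisc hσ hτ _ _ _) ?_
    have := hσ.wronskian_ne_zero hα0' hβ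
    simp only [sqrtDisc]
    positivity
  · obtain ⟨A, J, hJ, h1, h2, h3⟩ := exists_span_pow_three_eq hI hδ0 hδ hα hα0
    exact ⟨A, J, hJ, by rw [h1, h.two_mul_sqrtDisc_mul hδ0'], h2, h3⟩

theorem IsTwistedForm.mem_range_of_fst_eq_zero (hσ : IsQuadConj σ) (hτ0 : τ ≠ 0)
    {I : Ideal (𝓞 F)} (hI : I ∈ nonZeroDivisors (Ideal (𝓞 F))) {δ α β : 𝓞 F} (hδ0 : δ ≠ 0)
    (hδ : I ^ 3 = Ideal.span {δ}) (hα : α ∈ I) (hα0 : α ≠ 0)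
    {c d e : 𝓞 k₀} (h : IsTwistedForm σ τ (δ : F) α β 0 c d e) :
    ClassGroup.mk0 ⟨I, hI⟩ ∈ (ClassGroup.extendedHom (𝓞 k₀) (𝓞 F)).range := by
  obtain ⟨A, J, hJ, h1, h2, h3⟩ := exists_span_pow_three_eq hI hδ0 hδ hα hα0
  have h4 := h.fst
  rw [← h1] at h4
  have h5 : σ (A : F) = A := by
    have : τ * ((A : F) - σ A) = 0 := by rw [← h4]; simp
    exact (sub_eq_zero.1 ((mul_eq_zero.1 this).resolve_left hτ0)).symm
  obtain ⟨a, ha⟩ := hσ.exists_ringOfIntegers h5 (RingOfIntegers.isIntegral_coe A)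
  have h6 : A = algebraMap (𝓞 k₀) (𝓞 F) a := RingOfIntegers.ext ha.symm
  rw [h6] at h2
  have := mk0_mem_range_of_pow_three_eq hJ hσ.finrank_eq h2
  rw [h3] at this
  exact inv_mem_iff.1 this

theorem IsTwistedForm.cubicDisc_mem (hσ : IsQuadConj σ)
    (hτ : ∀ x : 𝓞 F, ∃ c : 𝓞 k₀, algebraMap k₀ F c = τ * (x - σ x))
    {I : Ideal (𝓞 F)} (hI : I ≠ ⊥) {δ α β : 𝓞 F} (hδ0 : δ ≠ 0)
    (hδ : I ^ 3 = Ideal.span {δ}) (hα : α ∈ I) (hβ : β ∈ I)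
    {b c d e : 𝓞 k₀} (h : IsTwistedForm σ τ (δ : F) α β b c d e)
    {p : Ideal (𝓞 k₀)} (hp : p.IsPrime)
    (hp0 : p ≠ ⊥) {P : Ideal (𝓞 F)} (hP : P.IsPrime)
    (hpP : p.map (algebraMap (𝓞 k₀) (𝓞 F)) = P ^ 2) : cubicDisc b c d e ∈ p := by
  refine mem_of_algebraMap_mem_of_ramified hp hp0 hP hpP ?_
  obtain ⟨ρ, hρ, g, hgP, hg⟩ := exists_scaling_notMem hI hP hδ
  obtain ⟨α₁, hα₁⟩ := hρ α hα
  obtain ⟨β₁, hβ₁⟩ := hρ β hβ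
  obtain ⟨c₁, hc₁⟩ := hτ (α₁ * intConj σ β₁)
  have hW := hσ.sub_mem_of_ramified hp hp0 hpP (α₁ * intConj σ β₁)
  set W := α₁ * intConj σ β₁ - intConj σ (α₁ * intConj σ β₁) with hWdef
  have hσg : intConj σ g ∉ P := fun hh => hgP (by
    simpa using add_mem (hσ.sub_mem_of_ramified hp hp0 hpP g) hh)
  have hδ0' : (δ : F) ≠ 0 := by simpa
  have hσδ : σ (δ : F) ≠ 0 := by simpa
  have key : algebraMap (𝓞 k₀) (𝓞 F) (cubicDisc b c d e) * (g * intConj σ g) ^ 2 =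
      (algebraMap (𝓞 k₀) (𝓞 F) c₁) ^ 4 * W * W := by
    apply RingOfIntegers.ext
    have e1 : ((algebraMap (𝓞 k₀) (𝓞 F) (cubicDisc b c d e) : 𝓞 F) : F) =
      sqrtDisc σ τ (δ : F) α β ^ 2 := (h.sq_sqrtDisc hδ0').symm
    have e2 : ((algebraMap (𝓞 k₀) (𝓞 F) c₁ : 𝓞 F) : F) = τ * (W : F) := by
      refine hc₁.trans ?_
      simp [hWdef]
    have e3 : (W : F) = ρ * σ ρ * (α * σ (β : F) - σ (α : F) * β) := by
      simp only [hWdef, map_mul, map_sub, coe_intConj, hα₁, hβ₁, hσ.invol]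
      ring
    change ((algebraMap (𝓞 k₀) (𝓞 F) (cubicDisc b c d e) : 𝓞 F) : F) * ((g : F) * σ g) ^ 2 =
      ((algebraMap (𝓞 k₀) (𝓞 F) c₁ : 𝓞 F) : F) ^ 4 * (W : F) * W
    rw [e1, e2, e3, hg, sqrtDisc]
    simp only [map_mul, map_pow]
    field_simp
  have h1 : algebraMap (𝓞 k₀) (𝓞 F) (cubicDisc b c d e) * (g * intConj σ g) ^ 2 ∈ P :=
    key ▸ P.mul_mem_left _ hW
  refine (hP.mem_or_mem h1).resolve_right fun h2 => ?_
  rcases hP.mem_or_mem (hP.mem_of_pow_mem _ h2) with h3 | h3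
  · exact hgP h3
  · exact hσg h3

theorem twistedTrace_le {δ y : F} (hδ : δ ≠ 0) {t M : ℝ}
    (hτ : ∀ w : InfinitePlace F, w τ ≤ t) (hy : ∀ w : InfinitePlace F, w y ≤ M * w δ)
    {c : 𝓞 k₀} (hc : algebraMap k₀ F c = τ * (y / δ - σ (y / δ))) (v : InfinitePlace k₀) :
    v c ≤ 2 * t * M := by
  obtain ⟨w, rfl⟩ := comap_surjective (K := F) v
  have h1 : ∀ w : InfinitePlace F, w (y / δ) ≤ M := fun w => by
    rw [map_div₀, div_le_iff₀ (w.pos_iff.2 hδ)]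
    exact hy w
  have h2 : w (σ (y / δ)) ≤ M := h1 (w.comap (σ : F →+* F))
  calc w (algebraMap k₀ F c) = w τ * w (y / δ - σ (y / δ)) := by rw [hc, map_mul]
    _ ≤ t * (M + M) := by
        refine mul_le_mul (hτ w) ((infinitePlace_sub_le _ _ _).trans (add_le_add (h1 w) h2))
          (apply_nonneg _ _) ((apply_nonneg _ _).trans (hτ w))
    _ = _ := by ring

end QuadConj

section QuadConj

variable {k₀ F : Type*} [Field k₀] [NumberField k₀] [Field F] [NumberField F] [Algebra k₀ F]
variable {σ : F ≃ₐ[k₀] F} {τ : F}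

/-- A class of order dividing three in a quadratic extension either comes from the base field
or is represented by a family of integral binary cubic forms with small coefficients. -/
theorem IsQuadConj.mem_range_or_exists_form (hσ : IsQuadConj σ) {Y : ℝ} (hY : 0 < Y)
    (hYD : Y ^ (2 * finrank ℚ k₀) = √|discr F|) (hτ0 : τ ≠ 0) (hτ : σ τ = -τ)
    (hτY : ∀ w : InfinitePlace F, w τ ≤ conjBound k₀ ^ 2 / (16 * Y ^ 2))
    (hτ' : ∀ x : 𝓞 F, ∃ c : 𝓞 k₀, algebraMap k₀ F c = τ * (x - σ x))
    {x : ClassGroup (𝓞 F)} (hx : x ^ 3 = 1) :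
    x ∈ (ClassGroup.extendedHom (𝓞 k₀) (𝓞 F)).range ∨ ∃ (j : ℕ) (b c : 𝓞 k₀), b ≠ 0 ∧
      ∀ u : 𝓞 k₀, (∀ v : InfinitePlace k₀, v u ≤ 4 ^ j) → ∃ c' d' e' : 𝓞 k₀,
        c' = c + b * u ∧
        (∀ v : InfinitePlace k₀, v b ≤ 27 * conjBound k₀ ^ 2 * (2⁻¹ ^ j) ^ 3 * Y) ∧
        (∀ v : InfinitePlace k₀, v c' ≤ 27 * conjBound k₀ ^ 2 * 2⁻¹ ^ j * Y) ∧
        (∀ v : InfinitePlace k₀, v d' ≤ 27 * conjBound k₀ ^ 2 * 2 ^ j * Y) ∧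
        (∀ v : InfinitePlace k₀, v e' ≤ 27 * conjBound k₀ ^ 2 * (2 ^ j) ^ 3 * Y) ∧
        (∃ s : F, IsFormDatum τ x b c' d' e' s) ∧
        ∀ p : Ideal (𝓞 k₀), p.IsPrime → p ≠ ⊥ → ∀ P : Ideal (𝓞 F), P.IsPrime →
          p.map (algebraMap (𝓞 k₀) (𝓞 F)) = P ^ 2 → cubicDisc b c' d' e' ∈ p := by
  obtain ⟨⟨I, hI⟩, rfl⟩ := ClassGroup.mk0_surjective x
  have hI0 : I ≠ ⊥ := mem_nonZeroDivisors_iff_ne_zero.1 hI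
  rw [← map_pow, ClassGroup.mk0_eq_one_iff] at hx
  obtain ⟨δ, hδ⟩ := hx
  replace hδ : I ^ 3 = Ideal.span {δ} := hδ
  have hδ0 : δ ≠ 0 := by
    rintro rfl
    rw [Ideal.span_singleton_zero] at hδ
    exact pow_ne_zero 3 hI0 hδ
  have hδ0' : (δ : F) ≠ 0 := by simpa
  set g : InfinitePlace F → ℝ := fun w => (w (δ : F)) ^ ((1 : ℝ) / 3) with hg
  have hg3 : ∀ w, g w ^ 3 = w (δ : F) := fun w => by
    rw [hg, ← Real.rpow_natCast, ← Real.rpow_mul (apply_nonneg _ _)]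
    norm_num
  have hgpos : ∀ w, 0 < g w := fun w => Real.rpow_pos_of_pos (w.pos_iff.2 hδ0') _
  have hgI : ∏ w, g w ^ mult w = Ideal.absNorm I := by
    have h1 : (∏ w, g w ^ mult w) ^ 3 = (Ideal.absNorm I : ℝ) ^ 3 := by
      rw [← Finset.prod_pow]
      simp_rw [← pow_mul, mul_comm _ 3, pow_mul, hg3]
      rw [prod_eq_abs_norm, ← Algebra.coe_norm_int, ← Nat.cast_pow, ← map_pow, hδ,
        Ideal.absNorm_span_singleton]
      simp [Nat.cast_natAbs]
    exact (pow_left_inj₀ (Finset.prod_nonneg fun w _ => pow_nonneg (hgpos w).le _)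
      (Nat.cast_nonneg _) three_ne_zero).1 h1
  obtain ⟨j, α, β, hα, hβ, hα0, hαβ, hαb, hβb⟩ :=
    exists_two_short_vectors k₀ hσ.finrank_eq hI0 hgpos hgI hY hYD
  obtain ⟨b, c, d, e, hform⟩ := exists_isTwistedForm hτ' hδ0 hδ hα hβ
  by_cases hb : b = 0
  · subst hb
    exact Or.inl (hform.mem_range_of_fst_eq_zero hσ hτ0 hI hδ0 hδ hα hα0)
  refine Or.inr ⟨j, b, c, hb, fun u hu => ?_⟩
  set β' := β + algebraMap (𝓞 k₀) (𝓞 F) u * α with hβ'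
  have hβ'I : β' ∈ I := add_mem hβ (I.mul_mem_left _ hα)
  have hβ'n : ∀ c : k₀, (β' : F) ≠ c • (α : F) := by
    intro c hc
    refine hαβ (c - u) ?_
    have h1 : (β : F) + algebraMap k₀ F u * α = c • (α : F) := hc
    rw [sub_smul, ← h1, Algebra.smul_def]
    ring
  have h2j : (2⁻¹ : ℝ) ^ j * 2 ^ j = 1 := by rw [← mul_pow]; norm_num
  have hαb' : ∀ w : InfinitePlace F, w α ≤ 2 * 2⁻¹ ^ j * Y * g w := fun w => (hαb w).le
  have hβ'b : ∀ w : InfinitePlace F, w β' ≤ 6 * 2 ^ j * Y * g w := by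
    intro w
    have h1 : w (algebraMap k₀ F u) ≤ 4 ^ j := hu (w.comap (algebraMap k₀ F))
    calc w β' = w ((β : F) + algebraMap k₀ F u * α) := rfl
      _ ≤ w β + w (algebraMap k₀ F u) * w α := by
          rw [← map_mul]; exact infinitePlace_add_le _ _ _
      _ ≤ 4 * 2 ^ j * Y * g w + 4 ^ j * (2 * 2⁻¹ ^ j * Y * g w) := by
          have := hgpos w
          have := (hβb w).le
          have := hαb' w
          gcongr
      _ = _ := by
          have : (4 : ℝ) ^ j = 2 ^ j * 2 ^ j := by rw [← mul_pow]; norm_num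
          rw [this]
          linear_combination 2 * 2 ^ j * Y * g w * h2j
  have hform' : IsTwistedForm σ τ (δ : F) α β' b _ _ _ := hform.add_mul u
  set c' := c + b * u
  set d' := d + 2 * c * u + b * u ^ 2
  set e' := e + 3 * d * u + 3 * c * u ^ 2 + b * u ^ 3
  have hcb := conjBound_pos k₀
  refine ⟨c', d', e', rfl, fun v => ?_, fun v => ?_, fun v => ?_, fun v => ?_,
    ⟨_, hform'.isFormDatum hσ hτ0 hτ hI hδ0 hδ hα hα0 hβ'n⟩,
    fun p hp hp0 P hP hpP => hform'.cubicDisc_mem hσ hτ' hI0 hδ0 hδ hα hβ'I hp hp0 hP hpP⟩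
  · refine (twistedTrace_le hδ0' hτY (M := (2 * 2⁻¹ ^ j * Y) ^ 3) (fun w => ?_)
      hform'.fst v).trans ?_
    · rw [← hg3, ← mul_pow, map_pow]
      exact pow_le_pow_left₀ (apply_nonneg _ _) (hαb' w) 3
    · have : 2 * (conjBound k₀ ^ 2 / (16 * Y ^ 2)) * (2 * 2⁻¹ ^ j * Y) ^ 3 =
          1 * conjBound k₀ ^ 2 * (2⁻¹ ^ j) ^ 3 * Y := by field_simp; ring
      rw [this]
      gcongr; norm_num
  · refine (twistedTrace_le hδ0' hτY (M := (2 * 2⁻¹ ^ j * Y) ^ 2 * (6 * 2 ^ j * Y)) (fun w => ?_)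
      hform'.snd v).trans ?_
    · have h1 := hgpos w
      rw [← hg3, map_mul, map_pow]
      calc _ ≤ (2 * 2⁻¹ ^ j * Y * g w) ^ 2 * (6 * 2 ^ j * Y * g w) :=
            mul_le_mul (pow_le_pow_left₀ (apply_nonneg _ _) (hαb' w) 2) (hβ'b w)
              (apply_nonneg _ _) (by positivity)
        _ = _ := by ring
    · have : 2 * (conjBound k₀ ^ 2 / (16 * Y ^ 2)) * ((2 * 2⁻¹ ^ j * Y) ^ 2 * (6 * 2 ^ j * Y)) =
          3 * conjBound k₀ ^ 2 * 2⁻¹ ^ j * Y := by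
        have h3 : 2 * (conjBound k₀ ^ 2 / (16 * Y ^ 2)) * ((2 * 2⁻¹ ^ j * Y) ^ 2 * (6 * 2 ^ j * Y))
          = 3 * conjBound k₀ ^ 2 * 2⁻¹ ^ j * Y * (2⁻¹ ^ j * 2 ^ j) := by
          generalize (2⁻¹ : ℝ) ^ j = a
          generalize (2 : ℝ) ^ j = b
          field_simp; ring
        rw [h3, h2j, mul_one]
      rw [this]
      gcongr; norm_num
  · refine (twistedTrace_le hδ0' hτY (M := (2 * 2⁻¹ ^ j * Y) * (6 * 2 ^ j * Y) ^ 2) (fun w => ?_)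
      hform'.trd v).trans ?_
    · have h1 := hgpos w
      rw [← hg3, map_mul, map_pow]
      calc _ ≤ (2 * 2⁻¹ ^ j * Y * g w) * (6 * 2 ^ j * Y * g w) ^ 2 :=
            mul_le_mul (hαb' w) (pow_le_pow_left₀ (apply_nonneg _ _) (hβ'b w) 2)
              (by positivity) (by positivity)
        _ = _ := by ring
    · have : 2 * (conjBound k₀ ^ 2 / (16 * Y ^ 2)) * ((2 * 2⁻¹ ^ j * Y) * (6 * 2 ^ j * Y) ^ 2) =
          9 * conjBound k₀ ^ 2 * 2 ^ j * Y := by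
        have h3 : 2 * (conjBound k₀ ^ 2 / (16 * Y ^ 2)) * ((2 * 2⁻¹ ^ j * Y) * (6 * 2 ^ j * Y) ^ 2)
          = 9 * conjBound k₀ ^ 2 * 2 ^ j * Y * (2⁻¹ ^ j * 2 ^ j) := by
          generalize (2⁻¹ : ℝ) ^ j = a
          generalize (2 : ℝ) ^ j = b
          field_simp; ring
        rw [h3, h2j, mul_one]
      rw [this]
      gcongr; norm_num
  · refine (twistedTrace_le hδ0' hτY (M := (6 * 2 ^ j * Y) ^ 3) (fun w => ?_)
      hform'.fth v).trans ?_
    · rw [← hg3, ← mul_pow, map_pow]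
      exact pow_le_pow_left₀ (apply_nonneg _ _) (hβ'b w) 3
    · refine le_of_eq ?_
      field_simp; ring

/-- A quadratic extension is generated by the square root of a small element divisible by all
ramified primes. -/
theorem IsQuadConj.exists_generator (hσ : IsQuadConj σ) {Y : ℝ} (hY : 0 < Y)
    (hYD : Y ^ (2 * finrank ℚ k₀) = √|discr F|) :
    ∃ (r : F) (d : 𝓞 k₀), (∀ a : k₀, algebraMap k₀ F a ≠ r) ∧ r ^ 2 = algebraMap k₀ F d ∧ d ≠ 0 ∧
      (∀ v : InfinitePlace k₀, v d ≤ 256 * Y ^ 4) ∧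
      ∀ p : Ideal (𝓞 k₀), p.IsPrime → p ≠ ⊥ → ∀ P : Ideal (𝓞 F), P.IsPrime →
        p.map (algebraMap (𝓞 k₀) (𝓞 F)) = P ^ 2 → d ∈ p := by
  obtain ⟨r, z, hr0, hrz, hσr, hr⟩ := hσ.exists_antiinvariant hY hYD
  have hr0' : (r : F) ≠ 0 := by simpa
  obtain ⟨d, hd⟩ := hσ.exists_ringOfIntegers (x := (r : F) ^ 2) (by rw [map_pow, hσr]; ring)
    ((RingOfIntegers.isIntegral_coe r).pow 2)
  refine ⟨r, d, IsQuadConj.notMem_of_apply_eq_neg hσr hr0', hd.symm, ?_, fun v => ?_,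
    fun p hp hp0 P hP hpP => ?_⟩
  · rintro rfl
    exact hr0' (eq_zero_of_pow_eq_zero (hd.symm.trans (map_zero (algebraMap k₀ F))))
  · obtain ⟨w, rfl⟩ := comap_surjective (K := F) v
    calc w (algebraMap k₀ F d) = w r ^ 2 := by rw [hd, map_pow]
      _ ≤ (16 * Y ^ 2) ^ 2 := pow_le_pow_left₀ (apply_nonneg _ _) (hr w) 2
      _ = _ := by ring
  · refine mem_of_algebraMap_mem_of_ramified hp hp0 hP hpP ?_
    have h1 : algebraMap (𝓞 k₀) (𝓞 F) d = r ^ 2 := RingOfIntegers.ext hd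
    rw [h1, pow_two]
    exact P.mul_mem_left _ (hrz ▸ hσ.sub_mem_of_ramified hp hp0 hpP z)

end QuadConj

theorem Set.finite_and_ncard_le_of_forall_finset {α : Type*} {S : Set α} {B : ℝ}
    (h : ∀ T : Finset α, (T : Set α) ⊆ S → (T.card : ℝ) ≤ B) :
    S.Finite ∧ (S.ncard : ℝ) ≤ B := by
  have hfin : S.Finite := by
    by_contra hinf
    obtain ⟨T, hT, hcard⟩ := Set.Infinite.exists_subset_card_eq hinf (⌊B⌋₊ + 1)
    have h1 := h T hT
    rw [hcard] at h1
    push_cast at h1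
    linarith [Nat.lt_floor_add_one B]
  refine ⟨hfin, ?_⟩
  rw [Set.ncard_eq_toFinset_card S hfin]
  exact h _ (by simp)

open MeasureTheory Measure in
theorem card_le_of_separated {E : Type*} [NormedAddCommGroup E] [NormedSpace ℝ E]
    [FiniteDimensional ℝ E] [Nontrivial E] {T : Finset E} {ρ Z : ℝ} (hρ : 0 < ρ) (hZ : 0 ≤ Z)
    (hsep : ∀ x ∈ T, ∀ y ∈ T, x ≠ y → ρ ≤ ‖x - y‖) (hT : ∀ x ∈ T, ‖x‖ ≤ Z) :
    (T.card : ℝ) ≤ (2 * Z / ρ + 1) ^ finrank ℝ E := by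
  let _ : MeasurableSpace E := borel E
  have : BorelSpace E := ⟨rfl⟩
  let μ : Measure E := addHaar
  have hdisj : (T : Set E).PairwiseDisjoint fun x => Metric.ball x (ρ / 2) := by
    intro x hx y hy hxy
    refine Metric.ball_disjoint_ball ?_
    rw [add_halves, dist_eq_norm]
    exact hsep x hx y hy hxy
  have h1 : μ (⋃ x ∈ T, Metric.ball x (ρ / 2)) ≤ μ (Metric.ball 0 (Z + ρ / 2)) := by
    refine measure_mono (Set.iUnion₂_subset fun x hx => ?_)
    refine Metric.ball_subset_ball' ?_
    rw [dist_zero_right]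
    linarith [hT x hx]
  rw [measure_biUnion_finset hdisj fun _ _ => measurableSet_ball] at h1
  simp_rw [addHaar_ball μ _ (by positivity : (0 : ℝ) ≤ ρ / 2)] at h1
  rw [addHaar_ball μ _ (by positivity : (0 : ℝ) ≤ Z + ρ / 2), Finset.sum_const, nsmul_eq_mul,
    ← mul_assoc] at h1
  have h2 := (ENNReal.mul_le_mul_iff_left (Metric.measure_ball_pos μ 0 one_pos).ne'
    measure_ball_lt_top.ne).1 h1
  rw [← ENNReal.ofReal_natCast, ← ENNReal.ofReal_mul (Nat.cast_nonneg _),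
    ENNReal.ofReal_le_ofReal_iff (by positivity)] at h2
  have h3 : (0 : ℝ) < (ρ / 2) ^ finrank ℝ E := by positivity
  rw [← le_div_iff₀ h3, ← div_pow] at h2
  have h4 : 2 * Z / ρ + 1 = (Z + ρ / 2) / (ρ / 2) := by
    field_simp
  rw [h4]
  exact h2

section Count

variable (k₀ : Type*) [Field k₀] [NumberField k₀]

theorem norm_mixedEmbedding_le {Z : ℝ} {x : k₀} (h : ∀ v : InfinitePlace k₀, v x ≤ Z) :
    ‖mixedEmbedding k₀ x‖ ≤ Z := by
  rw [mixedEmbedding.norm_eq_sup'_normAtPlace]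
  exact Finset.sup'_le _ _ fun v _ => by rw [mixedEmbedding.normAtPlace_apply]; exact h v

theorem le_norm_mixedEmbedding (x : k₀) (v : InfinitePlace k₀) :
    v x ≤ ‖mixedEmbedding k₀ x‖ := by
  rw [mixedEmbedding.norm_eq_sup'_normAtPlace, ← mixedEmbedding.normAtPlace_apply]
  exact Finset.le_sup' (fun w => mixedEmbedding.normAtPlace w (mixedEmbedding k₀ x))
    (Finset.mem_univ v)

variable {k₀}

theorem absNorm_le_of_mem {𝔞 : Ideal (𝓞 k₀)} {x : 𝓞 k₀} (hx : x ∈ 𝔞) (hx0 : x ≠ 0) {Z : ℝ}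
    (h : ∀ v : InfinitePlace k₀, v x ≤ Z) : (Ideal.absNorm 𝔞 : ℝ) ≤ Z ^ finrank ℚ k₀ := by
  have h1 : Ideal.absNorm 𝔞 ≤ (Algebra.norm ℤ x).natAbs := by
    rw [← Ideal.absNorm_span_singleton]
    refine Nat.le_of_dvd (Nat.pos_of_ne_zero ?_)
      (Ideal.absNorm_dvd_absNorm_of_le ((Ideal.span_singleton_le_iff_mem _).2 hx))
    rw [Ne, Ideal.absNorm_eq_zero_iff]
    simpa
  calc (Ideal.absNorm 𝔞 : ℝ) ≤ (Algebra.norm ℤ x).natAbs := by exact_mod_cast h1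
    _ = ∏ v : InfinitePlace k₀, v x ^ mult v := by
      rw [prod_eq_abs_norm, ← Algebra.coe_norm_int]
      simp [Nat.cast_natAbs]
    _ ≤ _ := by
      rw [← sum_mult_eq, ← Finset.prod_pow_eq_pow_sum]
      exact Finset.prod_le_prod (fun w _ => by positivity)
        fun w _ => pow_le_pow_left₀ (apply_nonneg _ _) (h w) _

/-- Counting integers of bounded size in a residue class. -/
theorem ncard_residue_le {𝔞 : Ideal (𝓞 k₀)} (h𝔞 : 𝔞 ≠ ⊥) (x₀ : 𝓞 k₀) {Z : ℝ} (hZ : 0 ≤ Z) :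
    {x : 𝓞 k₀ | x - x₀ ∈ 𝔞 ∧ ∀ v : InfinitePlace k₀, v x ≤ Z}.Finite ∧
    ({x : 𝓞 k₀ | x - x₀ ∈ 𝔞 ∧ ∀ v : InfinitePlace k₀, v x ≤ Z}.ncard : ℝ) ≤
      4 ^ finrank ℚ k₀ * (Z ^ finrank ℚ k₀ / Ideal.absNorm 𝔞 + 1) := by
  refine Set.finite_and_ncard_le_of_forall_finset fun T hT => ?_
  set n := finrank ℚ k₀ with hn
  have hn0 : n ≠ 0 := finrank_pos.ne'
  have hN : (0 : ℝ) < Ideal.absNorm 𝔞 := by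
    have : Ideal.absNorm 𝔞 ≠ 0 := by rwa [Ne, Ideal.absNorm_eq_zero_iff]
    positivity
  set ρ : ℝ := (Ideal.absNorm 𝔞 : ℝ) ^ ((n : ℝ)⁻¹) with hρdef
  have hρ : 0 < ρ := Real.rpow_pos_of_pos hN _
  have hρn : ρ ^ n = Ideal.absNorm 𝔞 := Real.rpow_inv_natCast_pow hN.le hn0
  have hinj : Function.Injective fun x : 𝓞 k₀ => mixedEmbedding k₀ (x : k₀) :=
    (mixedEmbedding_injective k₀).comp RingOfIntegers.coe_injective
  have h1 := card_le_of_separated (E := mixedEmbedding.mixedSpace k₀)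
    (T := T.image fun x : 𝓞 k₀ => mixedEmbedding k₀ (x : k₀)) hρ hZ ?_ ?_
  · rw [Finset.card_image_of_injective _ hinj, mixedEmbedding.finrank] at h1
    have ht : 0 ≤ Z / ρ := by positivity
    calc (T.card : ℝ) ≤ (2 * Z / ρ + 1) ^ n := h1
      _ ≤ (4 * max (Z / ρ) 1) ^ n := by
        gcongr
        have := le_max_left (Z / ρ) 1
        have := le_max_right (Z / ρ) 1
        have : 2 * Z / ρ = 2 * (Z / ρ) := by ring
        linarith
      _ = 4 ^ n * max (Z / ρ) 1 ^ n := mul_pow _ _ _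
      _ ≤ _ := by
        gcongr
        have h2 : Z ^ n / Ideal.absNorm 𝔞 = (Z / ρ) ^ n := by rw [div_pow, hρn]
        rw [h2]
        rcases max_cases (Z / ρ) 1 with ⟨h, -⟩ | ⟨h, -⟩ <;> rw [h]
        · linarith
        · rw [one_pow]; linarith [pow_nonneg ht n]
  · simp only [Finset.mem_image, forall_exists_index, and_imp, forall_apply_eq_imp_iff₂]
    intro x hx y hy hxy
    have hmem : x - y ∈ 𝔞 := by
      have := sub_mem (hT hx).1 (hT hy).1
      simpa using this
    have hne : x - y ≠ 0 := fun h => hxy (by rw [sub_eq_zero.1 h])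
    rw [← map_sub]
    have h3 := absNorm_le_of_mem hmem hne (le_norm_mixedEmbedding k₀ ((x - y : 𝓞 k₀) : k₀))
    rw [← hρn] at h3
    exact le_of_pow_le_pow_left₀ hn0 (norm_nonneg _) h3
  · simp only [Finset.mem_image, forall_exists_index, and_imp, forall_apply_eq_imp_iff₂]
    exact fun x hx => norm_mixedEmbedding_le k₀ (hT hx).2

theorem ncard_ideal_le {𝔞 : Ideal (𝓞 k₀)} (h𝔞 : 𝔞 ≠ ⊥) {Z : ℝ} (hZ : 0 ≤ Z) :
    {x : 𝓞 k₀ | x ∈ 𝔞 ∧ x ≠ 0 ∧ ∀ v : InfinitePlace k₀, v x ≤ Z}.Finite ∧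
    ({x : 𝓞 k₀ | x ∈ 𝔞 ∧ x ≠ 0 ∧ ∀ v : InfinitePlace k₀, v x ≤ Z}.ncard : ℝ) ≤
      2 * 4 ^ finrank ℚ k₀ * (Z ^ finrank ℚ k₀ / Ideal.absNorm 𝔞) := by
  obtain ⟨h1, h2⟩ := ncard_residue_le h𝔞 0 hZ
  have hsub : {x : 𝓞 k₀ | x ∈ 𝔞 ∧ x ≠ 0 ∧ ∀ v : InfinitePlace k₀, v x ≤ Z} ⊆
      {x : 𝓞 k₀ | x - 0 ∈ 𝔞 ∧ ∀ v : InfinitePlace k₀, v x ≤ Z} := fun x hx => by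
    simpa using ⟨hx.1, hx.2.2⟩
  refine ⟨h1.subset hsub, ?_⟩
  rcases Set.eq_empty_or_nonempty
    {x : 𝓞 k₀ | x ∈ 𝔞 ∧ x ≠ 0 ∧ ∀ v : InfinitePlace k₀, v x ≤ Z} with h | ⟨x, hx, hx0, hxZ⟩
  · rw [h, Set.ncard_empty, Nat.cast_zero]
    positivity
  · have hN : (0 : ℝ) < Ideal.absNorm 𝔞 := by
      have : Ideal.absNorm 𝔞 ≠ 0 := by rwa [Ne, Ideal.absNorm_eq_zero_iff]
      positivity
    have h3 : 1 ≤ Z ^ finrank ℚ k₀ / Ideal.absNorm 𝔞 := by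
      rw [one_le_div hN]
      exact absNorm_le_of_mem hx hx0 hxZ
    calc _ ≤ (({x : 𝓞 k₀ | x - 0 ∈ 𝔞 ∧ ∀ v : InfinitePlace k₀, v x ≤ Z}.ncard : ℕ) : ℝ) := by
          exact_mod_cast Set.ncard_le_ncard hsub h1
      _ ≤ _ := h2
      _ ≤ 4 ^ finrank ℚ k₀ * (Z ^ finrank ℚ k₀ / Ideal.absNorm 𝔞 +
          Z ^ finrank ℚ k₀ / Ideal.absNorm 𝔞) := by gcongr
      _ = _ := by ring

variable (k₀) in
/-- A lower bound for the number of integers of bounded size. -/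
theorem exists_le_ncard_box : ∃ c : ℝ, 0 < c ∧ ∀ Z : ℝ, 1 ≤ Z →
    c * Z ^ finrank ℚ k₀ ≤ {x : 𝓞 k₀ | ∀ v : InfinitePlace k₀, v x ≤ Z}.ncard := by
  set n := finrank ℚ k₀ with hn
  let ω := RingOfIntegers.basis k₀
  have hcard : Fintype.card (Free.ChooseBasisIndex ℤ (𝓞 k₀)) = n := by
    rw [← finrank_eq_card_basis ω, RingOfIntegers.rank]
  set M : ℝ := 1 + ∑ v : InfinitePlace k₀, ∑ i, v (ω i : k₀) with hM
  have hM1 : ∀ v : InfinitePlace k₀, ∑ i, v (ω i : k₀) ≤ M := fun v => by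
    have := Finset.single_le_sum (f := fun v : InfinitePlace k₀ => ∑ i, v (ω i : k₀))
      (fun v _ => Finset.sum_nonneg fun i _ => apply_nonneg _ _) (Finset.mem_univ v)
    linarith
  have hMpos : 0 < M := by
    have : 0 ≤ ∑ v : InfinitePlace k₀, ∑ i, v (ω i : k₀) :=
      Finset.sum_nonneg fun v _ => Finset.sum_nonneg fun i _ => apply_nonneg _ _
    linarith
  refine ⟨M⁻¹ ^ n, by positivity, fun Z hZ => ?_⟩
  have hZ0 : 0 ≤ Z := by linarith
  set m := ⌊Z / M⌋₊
  let f : (Free.ChooseBasisIndex ℤ (𝓞 k₀) → Fin (m + 1)) → 𝓞 k₀ :=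
    fun a => ω.equivFun.symm fun i => ((a i : ℕ) : ℤ)
  have hf : Function.Injective f := by
    intro a b hab
    have := ω.equivFun.symm.injective hab
    funext i
    have h2 := congrFun this i
    exact Fin.ext (by exact_mod_cast h2)
  have hbox : Set.range f ⊆ {x : 𝓞 k₀ | ∀ v : InfinitePlace k₀, v x ≤ Z} := by
    rintro _ ⟨a, rfl⟩ v
    have h1 : ((f a : 𝓞 k₀) : k₀) = ∑ i, ((a i : ℕ) : k₀) * (ω i : k₀) := by
      simp only [f, Basis.equivFun_symm_apply, map_sum]
      simp
    rw [h1]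
    calc v (∑ i, ((a i : ℕ) : k₀) * (ω i : k₀)) ≤ ∑ i, v (((a i : ℕ) : k₀) * (ω i : k₀)) := by
          rw [← v.norm_embedding_eq, map_sum]
          refine (norm_sum_le _ _).trans (le_of_eq ?_)
          simp only [v.norm_embedding_eq]
      _ ≤ ∑ i, Z / M * v (ω i : k₀) := by
          refine Finset.sum_le_sum fun i _ => ?_
          rw [map_mul, InfinitePlace.map_natCast]
          gcongr
          have h2 : (a i : ℕ) ≤ m := Nat.lt_succ_iff.1 (a i).2
          exact (Nat.cast_le.2 h2).trans (Nat.floor_le (by positivity))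
      _ = Z / M * ∑ i, v (ω i : k₀) := by rw [Finset.mul_sum]
      _ ≤ Z / M * M := by gcongr; exact hM1 v
      _ = Z := by field_simp
  have hfin : {x : 𝓞 k₀ | ∀ v : InfinitePlace k₀, v x ≤ Z}.Finite := by
    refine (ncard_residue_le (𝔞 := ⊤) (by simp) 0 hZ0).1.subset fun x hx => ⟨by simp, hx⟩
  calc M⁻¹ ^ n * Z ^ n = (Z / M) ^ n := by rw [← mul_pow]; ring
    _ ≤ ((m : ℝ) + 1) ^ n := by gcongr; exact (Nat.lt_floor_add_one _).le
    _ = (Set.range f).ncard := by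
      rw [← Set.image_univ, Set.ncard_image_of_injective _ hf, Set.ncard_univ, Nat.card_eq_fintype_card]
      simp [hcard]
    _ ≤ _ := by exact_mod_cast Set.ncard_le_ncard hbox hfin

end Count

theorem Set.ncard_le_mul_of_fiber {α β : Type*} {S : Set α} {f : α → β} {A : Set β} {a m : ℝ}
    (hA : A.Finite) (ha : (A.ncard : ℝ) ≤ a) (hS : ∀ x ∈ S, f x ∈ A) (hm0 : 0 ≤ m)
    (hm : ∀ y ∈ A, {x ∈ S | f x = y}.Finite ∧ ({x ∈ S | f x = y}.ncard : ℝ) ≤ m) :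
    S.Finite ∧ (S.ncard : ℝ) ≤ a * m := by
  refine Set.finite_and_ncard_le_of_forall_finset fun T hT => ?_
  have h1 : (T.card : ℝ) = ∑ y ∈ T.image f, ((T.filter fun x => f x = y).card : ℝ) := by
    exact_mod_cast Finset.card_eq_sum_card_image f T
  rw [h1]
  calc _ ≤ ∑ y ∈ T.image f, m := by
        refine Finset.sum_le_sum fun y hy => ?_
        obtain ⟨x, hx, rfl⟩ := Finset.mem_image.1 hy
        obtain ⟨h2, h3⟩ := hm (f x) (hS x (hT hx))
        refine le_trans ?_ h3
        have h4 := Set.ncard_le_ncard (s := ↑(T.filter fun z => f z = f x)) (fun z hz => by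
          have hz := Finset.mem_filter.1 (Finset.mem_coe.1 hz)
          exact ⟨hT hz.1, hz.2⟩) h2
        rw [Set.ncard_coe_finset] at h4
        exact_mod_cast h4
    _ = (T.image f).card * m := by rw [Finset.sum_const, nsmul_eq_mul]
    _ ≤ a * m := by
        gcongr
        refine le_trans ?_ ha
        have h4 := Set.ncard_le_ncard (s := ↑(T.image f)) (fun z hz => by
          obtain ⟨x, hx, rfl⟩ := Finset.mem_image.1 (Finset.mem_coe.1 hz)
          exact hS x (hT hx)) hA
        rw [Set.ncard_coe_finset] at h4
        exact_mod_cast h4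

section Count

variable {k₀ : Type*} [Field k₀] [NumberField k₀]

theorem mem_prod_of_forall_mem {s : Finset (Ideal (𝓞 k₀))} (hs : ∀ p ∈ s, p.IsPrime ∧ p ≠ ⊥)
    {x : 𝓞 k₀} (hx : ∀ p ∈ s, x ∈ p) : x ∈ ∏ p ∈ s, p := by
  rw [← Ideal.dvd_span_singleton]
  exact Finset.prod_primes_dvd _ (fun p hp => Ideal.prime_of_isPrime (hs p hp).2 (hs p hp).1)
    fun p hp => Ideal.dvd_span_singleton.2 (hx p hp)

theorem prod_ne_bot {s : Finset (Ideal (𝓞 k₀))} (hs : ∀ p ∈ s, p.IsPrime ∧ p ≠ ⊥) :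
    ∏ p ∈ s, p ≠ ⊥ :=
  Finset.prod_ne_zero_iff.2 fun p hp => (hs p hp).2

open Polynomial in
/-- The residues modulo `p` of the last coefficient of a form with discriminant divisible
by `p`. -/
theorem exists_roots_cubicDisc {p : Ideal (𝓞 k₀)} (hp : p.IsPrime) {b : 𝓞 k₀} (hb : b ∉ p)
    (c d : 𝓞 k₀) : ∃ R : Finset (𝓞 k₀ ⧸ p), R.card ≤ 2 ∧
      ∀ e, cubicDisc b c d e ∈ p → Ideal.Quotient.mk p e ∈ R := by
  let m := Ideal.Quotient.mk p
  let f : (𝓞 k₀ ⧸ p)[X] := C (m b ^ 2) * X ^ 2 + C (m (-6 * b * c * d + 4 * c ^ 3)) * X +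
    C (m (4 * b * d ^ 3 - 3 * c ^ 2 * d ^ 2))
  have hb0 : m b ^ 2 ≠ 0 := pow_ne_zero 2 fun h => hb (Ideal.Quotient.eq_zero_iff_mem.1 h)
  have hdeg : f.natDegree = 2 := natDegree_quadratic hb0
  refine ⟨f.roots.toFinset, ?_, fun e he => ?_⟩
  · exact (Multiset.toFinset_card_le _).trans ((card_roots' f).trans hdeg.le)
  · have hf0 : f ≠ 0 := by rintro h; rw [h] at hdeg; simp at hdeg
    rw [Multiset.mem_toFinset, mem_roots hf0, IsRoot]
    have h1 : f.eval (m e) = m (cubicDisc b c d e) := by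
      simp only [f, eval_add, eval_mul, eval_C, eval_pow, eval_X]
      simp only [cubicDisc, map_add, map_sub, map_mul, map_pow, map_neg, map_ofNat]
      ring
    rw [h1]
    exact Ideal.Quotient.eq_zero_iff_mem.2 he

theorem ncard_last_coeff_le {s : Finset (Ideal (𝓞 k₀))} (hs : ∀ p ∈ s, p.IsPrime ∧ p ≠ ⊥)
    {b : 𝓞 k₀} (hb : ∀ p ∈ s, b ∉ p) (c d : 𝓞 k₀) {Z : ℝ} (hZ : 0 ≤ Z) :
    {e : 𝓞 k₀ | (∀ v : InfinitePlace k₀, v e ≤ Z) ∧ ∀ p ∈ s, cubicDisc b c d e ∈ p}.Finite ∧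
    ({e : 𝓞 k₀ | (∀ v : InfinitePlace k₀, v e ≤ Z) ∧
      ∀ p ∈ s, cubicDisc b c d e ∈ p}.ncard : ℝ) ≤ 2 ^ s.card *
        (4 ^ finrank ℚ k₀ * (Z ^ finrank ℚ k₀ / Ideal.absNorm (∏ p ∈ s, p) + 1)) := by
  choose! R hR2 hR using fun (p : Ideal (𝓞 k₀)) (hp : p ∈ s) =>
    exists_roots_cubicDisc (hs p hp).1 (hb p hp) c d
  let R' : (p : s) → Finset (𝓞 k₀ ⧸ (p : Ideal (𝓞 k₀))) := fun p => R p
  refine Set.ncard_le_mul_of_fiber (f := fun e (p : s) => Ideal.Quotient.mk (p : Ideal (𝓞 k₀)) e)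
    (A := (Fintype.piFinset R' : Set ((p : s) → 𝓞 k₀ ⧸ (p : Ideal (𝓞 k₀)))))
    (Finset.finite_toSet _) ?_ ?_ (by positivity) ?_
  · rw [Set.ncard_coe_finset, Fintype.card_piFinset]
    have : ∏ p : s, (R' p).card ≤ ∏ _p : s, 2 :=
      Finset.prod_le_prod' fun p _ => hR2 p p.2
    rw [Finset.prod_const, Finset.card_univ, Fintype.card_coe] at this
    exact_mod_cast this
  · rintro e ⟨-, he⟩
    rw [Finset.mem_coe, Fintype.mem_piFinset]
    exact fun p => hR p p.2 e (he p p.2)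
  · intro y _
    rcases Set.eq_empty_or_nonempty {e ∈ {e : 𝓞 k₀ | (∀ v : InfinitePlace k₀, v e ≤ Z) ∧
      ∀ p ∈ s, cubicDisc b c d e ∈ p} | (fun p : s => Ideal.Quotient.mk (p : Ideal (𝓞 k₀)) e) = y}
      with h | ⟨e₀, -, he₀⟩
    · rw [h, Set.ncard_empty]
      exact ⟨Set.finite_empty, by rw [Nat.cast_zero]; positivity⟩
    · obtain ⟨h1, h2⟩ := ncard_residue_le (prod_ne_bot hs) e₀ hZ
      have hsub : {e ∈ {e : 𝓞 k₀ | (∀ v : InfinitePlace k₀, v e ≤ Z) ∧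
          ∀ p ∈ s, cubicDisc b c d e ∈ p} |
          (fun p : s => Ideal.Quotient.mk (p : Ideal (𝓞 k₀)) e) = y} ⊆
          {x : 𝓞 k₀ | x - e₀ ∈ ∏ p ∈ s, p ∧ ∀ v : InfinitePlace k₀, v x ≤ Z} := by
        rintro e ⟨⟨h3, -⟩, h4⟩
        refine ⟨mem_prod_of_forall_mem hs fun p hp => ?_, h3⟩
        exact Ideal.Quotient.eq.1 (congrFun (h4.trans he₀.symm) ⟨p, hp⟩)
      exact ⟨h1.subset hsub, le_trans (by exact_mod_cast Set.ncard_le_ncard hsub h1) h2⟩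

/-- Integral binary cubic forms in a box whose discriminant is divisible by given primes. -/
def formBox (s : Finset (Ideal (𝓞 k₀))) (Zb Zc Zd Ze : ℝ) :
    Set (𝓞 k₀ × 𝓞 k₀ × 𝓞 k₀ × 𝓞 k₀) :=
  {f | f.1 ≠ 0 ∧ (∀ v : InfinitePlace k₀, v f.1 ≤ Zb) ∧ (∀ v : InfinitePlace k₀, v f.2.1 ≤ Zc) ∧
    (∀ v : InfinitePlace k₀, v f.2.2.1 ≤ Zd) ∧ (∀ v : InfinitePlace k₀, v f.2.2.2 ≤ Ze) ∧
    ∀ p ∈ s, cubicDisc f.1 f.2.1 f.2.2.1 f.2.2.2 ∈ p}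

theorem ncard_box_le {Z : ℝ} (hZ : 1 ≤ Z) :
    {x : 𝓞 k₀ | ∀ v : InfinitePlace k₀, v x ≤ Z}.Finite ∧
    ({x : 𝓞 k₀ | ∀ v : InfinitePlace k₀, v x ≤ Z}.ncard : ℝ) ≤
      2 * 4 ^ finrank ℚ k₀ * Z ^ finrank ℚ k₀ := by
  obtain ⟨h1, h2⟩ := ncard_residue_le (k₀ := k₀) (𝔞 := ⊤) (by simp) 0 (zero_le_one.trans hZ)
  simp only [Submodule.mem_top, true_and, Ideal.absNorm_top, Nat.cast_one, div_one] at h1 h2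
  refine ⟨h1, h2.trans ?_⟩
  have := one_le_pow₀ hZ (n := finrank ℚ k₀)
  calc _ ≤ (4 : ℝ) ^ finrank ℚ k₀ * (Z ^ finrank ℚ k₀ + Z ^ finrank ℚ k₀) := by gcongr
    _ = _ := by ring

/-- The forms in a box whose leading coefficient is divisible by exactly the primes in `t`. -/
theorem ncard_formBox_stratum_le {s : Finset (Ideal (𝓞 k₀))} (hs : ∀ p ∈ s, p.IsPrime ∧ p ≠ ⊥)
    {t : Finset (Ideal (𝓞 k₀))} (hts : t ⊆ s) {Zb Zc Zd Ze : ℝ} (hZb : 0 ≤ Zb) (hZc : 1 ≤ Zc)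
    (hZd : 1 ≤ Zd) (hZe : 0 ≤ Ze) :
    {f ∈ formBox s Zb Zc Zd Ze | ∀ p ∈ s, f.1 ∈ p ↔ p ∈ t}.Finite ∧
    ({f ∈ formBox s Zb Zc Zd Ze | ∀ p ∈ s, f.1 ∈ p ↔ p ∈ t}.ncard : ℝ) ≤
      8 * 256 ^ finrank ℚ k₀ * 2 ^ s.card * (Zb * Zc * Zd) ^ finrank ℚ k₀ *
        (Ze ^ finrank ℚ k₀ / Ideal.absNorm (∏ p ∈ s, p) + 1) := by
  set n := finrank ℚ k₀ with hn
  have hst : ∀ p ∈ s \ t, p.IsPrime ∧ p ≠ ⊥ := fun p hp => hs p (Finset.mem_sdiff.1 hp).1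
  have ht : ∀ p ∈ t, p.IsPrime ∧ p ≠ ⊥ := fun p hp => hs p (hts hp)
  set G : ℝ := ((Ideal.absNorm (∏ p ∈ t, p) : ℕ) : ℝ) with hG
  set H : ℝ := ((Ideal.absNorm (∏ p ∈ s \ t, p) : ℕ) : ℝ) with hH
  have hGH : (Ideal.absNorm (∏ p ∈ s, p) : ℝ) = H * G := by
    rw [hG, hH, ← Nat.cast_mul, ← map_mul, Finset.prod_sdiff hts]
  have hpos : ∀ s : Finset (Ideal (𝓞 k₀)), (∀ p ∈ s, p.IsPrime ∧ p ≠ ⊥) →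
      (1 : ℝ) ≤ Ideal.absNorm (∏ p ∈ s, p) := fun s hs => by
    have : Ideal.absNorm (∏ p ∈ s, p) ≠ 0 := by
      rw [Ne, Ideal.absNorm_eq_zero_iff]; exact prod_ne_bot hs
    exact_mod_cast Nat.one_le_iff_ne_zero.2 this
  have hG1 : 1 ≤ G := hpos t ht
  have hH1 : 1 ≤ H := hpos _ hst
  obtain ⟨hb1, hb2⟩ := ncard_ideal_le (prod_ne_bot ht) hZb
  obtain ⟨hc1, hc2⟩ := ncard_box_le (k₀ := k₀) hZc
  obtain ⟨hd1, hd2⟩ := ncard_box_le (k₀ := k₀) hZd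
  have key := Set.ncard_le_mul_of_fiber
    (S := {f ∈ formBox s Zb Zc Zd Ze | ∀ p ∈ s, f.1 ∈ p ↔ p ∈ t})
    (f := fun f => ((f.1, f.2.1), f.2.2.1))
    (A := ({x : 𝓞 k₀ | x ∈ ∏ p ∈ t, p ∧ x ≠ 0 ∧ ∀ v : InfinitePlace k₀, v x ≤ Zb} ×ˢ
      {x : 𝓞 k₀ | ∀ v : InfinitePlace k₀, v x ≤ Zc}) ×ˢ
      {x : 𝓞 k₀ | ∀ v : InfinitePlace k₀, v x ≤ Zd})
    (a := (2 * 4 ^ n * (Zb ^ n / G)) * (2 * 4 ^ n * Zc ^ n) * (2 * 4 ^ n * Zd ^ n))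
    (m := 2 ^ s.card * (4 ^ n * (Ze ^ n / H + 1)))
    ((hb1.prod hc1).prod hd1) ?_ ?_ (by positivity) ?_
  · refine ⟨key.1, key.2.trans ?_⟩
    have h256 : (256 : ℝ) ^ n = 4 ^ n * 4 ^ n * 4 ^ n * 4 ^ n := by
      rw [← mul_pow, ← mul_pow, ← mul_pow]; norm_num
    rw [hGH, h256, mul_pow, mul_pow]
    calc _ = 8 * (4 ^ n * 4 ^ n * 4 ^ n * 4 ^ n) * 2 ^ s.card * (Zb ^ n * Zc ^ n * Zd ^ n) *
          (Ze ^ n / (H * G) + 1 / G) := by field_simp; ring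
      _ ≤ _ := by
        gcongr
        rw [div_le_one (by linarith)]
        exact hG1
  · rw [Set.ncard_prod, Set.ncard_prod]
    push_cast
    gcongr
  · rintro ⟨b, c, d, e⟩ ⟨⟨hb0, hb, hc, hd, he, hp⟩, hbt⟩
    exact ⟨⟨⟨mem_prod_of_forall_mem ht fun p hp => (hbt p (hts hp)).2 hp, hb0, hb⟩, hc⟩, hd⟩
  · rintro ⟨⟨b, c⟩, d⟩ -
    by_cases hbt : ∀ p ∈ s, b ∈ p ↔ p ∈ t
    · obtain ⟨he1, he2⟩ := ncard_last_coeff_le hst (b := b) (fun p hp hbp =>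
        (Finset.mem_sdiff.1 hp).2 ((hbt p (Finset.mem_sdiff.1 hp).1).1 hbp)) c d hZe
      have hsub : {x ∈ {f ∈ formBox s Zb Zc Zd Ze | ∀ p ∈ s, f.1 ∈ p ↔ p ∈ t} |
          ((x.1, x.2.1), x.2.2.1) = ((b, c), d)} ⊆ (fun e => (b, c, d, e)) ''
          {e : 𝓞 k₀ | (∀ v : InfinitePlace k₀, v e ≤ Ze) ∧
            ∀ p ∈ s \ t, cubicDisc b c d e ∈ p} := by
        rintro ⟨b', c', d', e'⟩ ⟨⟨⟨-, -, -, -, he, hp⟩, -⟩, heq⟩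
        simp only [Prod.mk.injEq] at heq
        obtain ⟨⟨rfl, rfl⟩, rfl⟩ := heq
        exact ⟨e', ⟨he, fun p hp' => hp p (Finset.mem_sdiff.1 hp').1⟩, rfl⟩
      refine ⟨(he1.image _).subset hsub, ?_⟩
      calc _ ≤ (((fun e => (b, c, d, e)) '' {e : 𝓞 k₀ | (∀ v : InfinitePlace k₀, v e ≤ Ze) ∧
            ∀ p ∈ s \ t, cubicDisc b c d e ∈ p}).ncard : ℝ) := by
            exact_mod_cast Set.ncard_le_ncard hsub (he1.image _)
        _ ≤ _ := by exact_mod_cast Set.ncard_image_le he1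
        _ ≤ _ := he2
        _ ≤ _ := by
          gcongr
          · norm_num
          · exact Finset.sdiff_subset
    · have : {x ∈ {f ∈ formBox s Zb Zc Zd Ze | ∀ p ∈ s, f.1 ∈ p ↔ p ∈ t} |
          ((x.1, x.2.1), x.2.2.1) = ((b, c), d)} = ∅ := by
        rw [Set.eq_empty_iff_forall_notMem]
        rintro ⟨b', c', d', e'⟩ ⟨⟨-, h⟩, heq⟩
        simp only [Prod.mk.injEq] at heq
        obtain ⟨⟨rfl, rfl⟩, rfl⟩ := heq
        exact hbt h
      rw [this, Set.ncard_empty, Nat.cast_zero]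
      exact ⟨Set.finite_empty, by positivity⟩

theorem ncard_formBox_le {s : Finset (Ideal (𝓞 k₀))} (hs : ∀ p ∈ s, p.IsPrime ∧ p ≠ ⊥)
    {Zb Zc Zd Ze : ℝ} (hZb : 0 ≤ Zb) (hZc : 1 ≤ Zc) (hZd : 1 ≤ Zd) (hZe : 0 ≤ Ze) :
    (formBox s Zb Zc Zd Ze).Finite ∧ ((formBox s Zb Zc Zd Ze).ncard : ℝ) ≤
      8 * 256 ^ finrank ℚ k₀ * 4 ^ s.card * (Zb * Zc * Zd) ^ finrank ℚ k₀ *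
        (Ze ^ finrank ℚ k₀ / Ideal.absNorm (∏ p ∈ s, p) + 1) := by
  have h := Set.ncard_le_mul_of_fiber (S := formBox s Zb Zc Zd Ze)
    (f := fun f => s.filter fun p => f.1 ∈ p) (A := (s.powerset : Set (Finset (Ideal (𝓞 k₀)))))
    (a := 2 ^ s.card) (m := 8 * 256 ^ finrank ℚ k₀ * 2 ^ s.card * (Zb * Zc * Zd) ^ finrank ℚ k₀ *
        (Ze ^ finrank ℚ k₀ / Ideal.absNorm (∏ p ∈ s, p) + 1)) (Finset.finite_toSet _) ?_ ?_
        (by positivity) ?_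
  · refine ⟨h.1, h.2.trans (le_of_eq ?_)⟩
    have : (4 : ℝ) ^ s.card = 2 ^ s.card * 2 ^ s.card := by rw [← mul_pow]; norm_num
    rw [this]
    ring
  · rw [Set.ncard_coe_finset, Finset.card_powerset]
    push_cast
    rfl
  · intro f _
    exact Finset.mem_coe.2 (Finset.mem_powerset.2 (Finset.filter_subset _ _))
  · intro t ht
    have hts : t ⊆ s := by simpa using ht
    have : {f ∈ formBox s Zb Zc Zd Ze | (s.filter fun p => f.1 ∈ p) = t} =
        {f ∈ formBox s Zb Zc Zd Ze | ∀ p ∈ s, f.1 ∈ p ↔ p ∈ t} := by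
      ext f
      simp only [Set.mem_ofPred_eq, and_congr_right_iff, Finset.ext_iff, Finset.mem_filter]
      intro _
      constructor
      · intro h p hp
        rw [← h p]
        simp [hp]
      · intro h p
        constructor
        · rintro ⟨hp, hf⟩
          exact (h p hp).1 hf
        · intro hp
          exact ⟨hts hp, (h p (hts hp)).2 hp⟩
    rw [this]
    exact ncard_formBox_stratum_le hs hts hZb hZc hZd hZe

end Count

section LevelBox

variable {k₀ : Type*} [Field k₀] [NumberField k₀]

theorem one_le_of_ne_zero {b : 𝓞 k₀} (hb : b ≠ 0) {Z : ℝ} (hZ : 0 ≤ Z)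
    (h : ∀ v : InfinitePlace k₀, v b ≤ Z) : 1 ≤ Z := by
  have h1 := absNorm_le_of_mem (𝔞 := ⊤) Submodule.mem_top hb h
  rw [Ideal.absNorm_top, Nat.cast_one] at h1
  exact (one_le_pow_iff_of_nonneg hZ finrank_pos.ne').1 h1

/-- The box containing the forms coming from a lattice of a given skewness `j`. -/
def levelBox (s : Finset (Ideal (𝓞 k₀))) (K Y : ℝ) (j : ℕ) : Set (𝓞 k₀ × 𝓞 k₀ × 𝓞 k₀ × 𝓞 k₀) :=
  formBox s (K * (2⁻¹ ^ j) ^ 3 * Y) (K * 2⁻¹ ^ j * Y) (K * 2 ^ j * Y) (K * (2 ^ j) ^ 3 * Y)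

theorem ncard_levelBox_le {s : Finset (Ideal (𝓞 k₀))} (hs : ∀ p ∈ s, p.IsPrime ∧ p ≠ ⊥)
    {K Y : ℝ} (hK : 0 ≤ K) (hY : 0 ≤ Y) (j : ℕ) :
    (levelBox s K Y j).Finite ∧ ((levelBox s K Y j).ncard : ℝ) ≤
      8 * 256 ^ finrank ℚ k₀ * 4 ^ s.card * (((K * Y) ^ finrank ℚ k₀) ^ 4 /
        Ideal.absNorm (∏ p ∈ s, p) + ((K * Y) ^ finrank ℚ k₀) ^ 3) := by
  rcases Set.eq_empty_or_nonempty (levelBox s K Y j) with h | ⟨f, hf⟩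
  · rw [h, Set.ncard_empty, Nat.cast_zero]
    exact ⟨Set.finite_empty, by positivity⟩
  have h2j : (2⁻¹ : ℝ) ^ j * 2 ^ j = 1 := by rw [← mul_pow]; norm_num
  have h2 : (2⁻¹ : ℝ) ^ j ≤ 1 := pow_le_one₀ (by norm_num) (by norm_num)
  have h2' : (1 : ℝ) ≤ 2 ^ j := one_le_pow₀ (by norm_num)
  have hZb : 1 ≤ K * (2⁻¹ ^ j) ^ 3 * Y := one_le_of_ne_zero hf.1 (by positivity) hf.2.1
  have hZc : 1 ≤ K * 2⁻¹ ^ j * Y := hZb.trans (by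
    gcongr; exact pow_le_of_le_one (by positivity) h2 (by norm_num))
  have hZd : 1 ≤ K * 2 ^ j * Y := hZc.trans (by
    have := h2.trans h2'
    gcongr K * ?_ * Y)
  obtain ⟨h3, h4⟩ := ncard_formBox_le hs (zero_le_one.trans hZb) hZc hZd
    (Ze := K * (2 ^ j) ^ 3 * Y) (by positivity)
  refine ⟨h3, h4.trans ?_⟩
  rw [mul_assoc (8 * 256 ^ finrank ℚ k₀ * 4 ^ s.card)]
  refine mul_le_mul_of_nonneg_left ?_ (by positivity)
  generalize (2⁻¹ : ℝ) ^ j = a at *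
  generalize (2 : ℝ) ^ j = b at *
  have ha : 0 ≤ a := by by_contra! ha; nlinarith
  rw [mul_add, mul_one, ← mul_div_assoc, ← mul_pow, ← pow_mul, mul_comm _ 4, pow_mul, ← pow_mul _ _ 3,
    mul_comm _ 3, pow_mul]
  refine add_le_add (div_le_div_of_nonneg_right (pow_le_pow_left₀ (by positivity) ?_ _)
    (by positivity)) (pow_le_pow_left₀ (by positivity) ?_ _)
  · refine le_of_eq ?_
    calc _ = (K * Y) ^ 4 * (a * b) ^ 4 := by ring
      _ = _ := by rw [h2j, one_pow, mul_one]
  · calc _ = (K * Y) ^ 3 * (a ^ 3 * (a * b)) := by ring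
      _ ≤ (K * Y) ^ 3 * 1 := by
        rw [h2j, mul_one]
        gcongr
        exact pow_le_one₀ ha h2
      _ = _ := mul_one _

end LevelBox

section QuadForms

variable {k₀ F : Type*} [Field k₀] [NumberField k₀] [Field F] [NumberField F] [Algebra k₀ F]

variable (k₀ F) in
theorem exists_pow_eq_sqrt_discr {Y : ℝ} (hY : 0 ≤ Y)
    (hYD : (|discr F| : ℝ) ≤ Y ^ (4 * finrank ℚ k₀)) :
    ∃ Y₀, 0 < Y₀ ∧ Y₀ ≤ Y ∧ Y₀ ^ (2 * finrank ℚ k₀) = √|discr F| := by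
  have hn : 2 * finrank ℚ k₀ ≠ 0 := mul_ne_zero two_ne_zero finrank_pos.ne'
  have hD : 0 < |(discr F : ℝ)| := by
    have := discr_ne_zero F
    positivity
  have hpow : (√|discr F| ^ ((2 * finrank ℚ k₀ : ℕ) : ℝ)⁻¹) ^ (2 * finrank ℚ k₀) =
      √|discr F| := Real.rpow_inv_natCast_pow (Real.sqrt_nonneg _) hn
  refine ⟨_, Real.rpow_pos_of_pos (Real.sqrt_pos.2 hD) _, ?_, hpow⟩
  refine le_of_pow_le_pow_left₀ hn hY ?_
  rw [hpow]
  refine Real.sqrt_le_iff.2 ⟨by positivity, hYD.trans (le_of_eq ?_)⟩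
  rw [← pow_mul]; ring_nf

/-- Three-torsion classes not coming from the base are represented by many forms in a box. -/
theorem exists_forms (h2 : finrank k₀ F = 2) {Y : ℝ} (hY : 0 ≤ Y)
    (hYD : (|discr F| : ℝ) ≤ Y ^ (4 * finrank ℚ k₀)) {s : Finset (Ideal (𝓞 k₀))}
    (hs : ∀ p ∈ s, p.IsPrime ∧ p ≠ ⊥)
    (hram : ∀ p ∈ s, ∃ P : Ideal (𝓞 F), P.IsPrime ∧ p.map (algebraMap (𝓞 k₀) (𝓞 F)) = P ^ 2) :
    ∃ τ : F, τ ≠ 0 ∧ ∀ x : ClassGroup (𝓞 F), x ^ 3 = 1 →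
      x ∈ (ClassGroup.extendedHom (𝓞 k₀) (𝓞 F)).range ∨
      ∃ (j : ℕ) (b c : 𝓞 k₀), ∀ u : 𝓞 k₀, (∀ v : InfinitePlace k₀, v u ≤ 4 ^ j) →
        ∃ d e, (b, c + b * u, d, e) ∈ levelBox s (27 * conjBound k₀ ^ 2) Y j ∧
          ∃ r : F, IsFormDatum τ x b (c + b * u) d e r := by
  obtain ⟨σ, hσ⟩ := exists_isQuadConj h2
  obtain ⟨Y₀, hY₀, hY₀Y, hY₀D⟩ := exists_pow_eq_sqrt_discr k₀ F hY hYD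
  obtain ⟨τ, hτ0, hτ, hτY, hτ'⟩ := hσ.exists_trace_twist hY₀ hY₀D
  refine ⟨τ, hτ0, fun x hx => ?_⟩
  rcases hσ.mem_range_or_exists_form hY₀ hY₀D hτ0 hτ hτY hτ' hx with h | ⟨j, b, c, hb0, h⟩
  · exact Or.inl h
  · refine Or.inr ⟨j, b, c, fun u hu => ?_⟩
    obtain ⟨_, d, e, rfl, hb, hc, hd, he, hr, hp⟩ := h u hu
    have hcb := conjBound_pos k₀
    refine ⟨d, e, ⟨hb0, fun v => (hb v).trans ?_, fun v => (hc v).trans ?_,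
      fun v => (hd v).trans ?_, fun v => (he v).trans ?_, fun p hps => ?_⟩, hr⟩
    any_goals gcongr
    obtain ⟨P, hP, hpP⟩ := hram p hps
    exact hp p (hs p hps).1 (hs p hps).2 P hP hpP

theorem exists_small_generator (h2 : finrank k₀ F = 2) {Y : ℝ} (hY : 0 ≤ Y)
    (hYD : (|discr F| : ℝ) ≤ Y ^ (4 * finrank ℚ k₀)) {s : Finset (Ideal (𝓞 k₀))}
    (hs : ∀ p ∈ s, p.IsPrime ∧ p ≠ ⊥)
    (hram : ∀ p ∈ s, ∃ P : Ideal (𝓞 F), P.IsPrime ∧ p.map (algebraMap (𝓞 k₀) (𝓞 F)) = P ^ 2) :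
    ∃ (r : F) (d : 𝓞 k₀), (∀ a : k₀, algebraMap k₀ F a ≠ r) ∧ r ^ 2 = algebraMap k₀ F d ∧
      d ∈ ∏ p ∈ s, p ∧ d ≠ 0 ∧ ∀ v : InfinitePlace k₀, v d ≤ 256 * Y ^ 4 := by
  obtain ⟨σ, hσ⟩ := exists_isQuadConj h2
  obtain ⟨Y₀, hY₀, hY₀Y, hY₀D⟩ := exists_pow_eq_sqrt_discr k₀ F hY hYD
  obtain ⟨r, d, hr, hrd, hd0, hd, hp⟩ := hσ.exists_generator hY₀ hY₀D
  refine ⟨r, d, hr, hrd, mem_prod_of_forall_mem hs fun p hps => ?_, hd0,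
    fun v => (hd v).trans (by gcongr)⟩
  obtain ⟨P, hP, hpP⟩ := hram p hps
  exact hp p (hs p hps).1 (hs p hps).2 P hP hpP

end QuadForms

theorem Set.ncard_le_two_of_sq {α Ω : Type*} [Field Ω] {S : Set α} {g : α → Ω} {D : Ω}
    (hg : ∀ x ∈ S, g x ^ 2 = D) (hinj : S.InjOn g) : S.Finite ∧ (S.ncard : ℝ) ≤ 2 := by
  rcases S.eq_empty_or_nonempty with rfl | ⟨y, hy⟩
  · exact ⟨Set.finite_empty, by simp⟩
  have hmem : ∀ x ∈ S, g x ∈ ({g y, -g y} : Set Ω) := fun x hx =>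
    sq_eq_sq_iff_eq_or_eq_neg.1 ((hg x hx).trans (hg y hy).symm)
  have hfin : ({g y, -g y} : Set Ω).Finite := by simp
  refine ⟨Set.Finite.of_injOn hmem hinj hfin, ?_⟩
  have h1 := Set.ncard_le_ncard_of_injOn g hmem hinj hfin
  have h2 := Set.ncard_insert_le (g y) {-g y}
  rw [Set.ncard_singleton] at h2
  exact_mod_cast h1.trans h2

section Quadratic

variable {k₀ Ω : Type*} [Field k₀] [NumberField k₀] [Field Ω] [Algebra k₀ Ω]

open IntermediateField in
theorem eq_adjoin_of_finrank_eq_two {F : IntermediateField k₀ Ω} (h2 : finrank k₀ F = 2) {r : F}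
    (hr : ∀ a : k₀, algebraMap k₀ F a ≠ r) : k₀⟮(r : Ω)⟯ = F := by
  have : FiniteDimensional k₀ F := FiniteDimensional.of_finrank_pos (by omega)
  have hle : k₀⟮(r : Ω)⟯ ≤ F := adjoin_simple_le_iff.2 r.2
  refine eq_of_le_of_finrank_le hle ?_
  have : FiniteDimensional k₀ k₀⟮(r : Ω)⟯ :=
    FiniteDimensional.of_injective (inclusion hle).toLinearMap (inclusion hle).injective
  have hpos : 0 < finrank k₀ k₀⟮(r : Ω)⟯ := finrank_pos
  have hne : finrank k₀ k₀⟮(r : Ω)⟯ ≠ 1 := by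
    rw [Ne, finrank_adjoin_simple_eq_one_iff, mem_bot]
    rintro ⟨a, ha⟩
    exact hr a (Subtype.ext ha)
  omega

/-- Classes in fields of `𝓕` represented by a full family of forms in the box of level `j`. -/
def levelClasses (𝓕 : Set (IntermediateField k₀ Ω)) (τ : ∀ F : IntermediateField k₀ Ω, F)
    (s : Finset (Ideal (𝓞 k₀))) (K Y : ℝ) (j : ℕ) :
    Set (Σ F : IntermediateField k₀ Ω, ClassGroup (𝓞 F)) :=
  {p | p.1 ∈ 𝓕 ∧ ∃ _ : NumberField p.1, ∃ b c : 𝓞 k₀, ∀ u : 𝓞 k₀,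
    (∀ v : InfinitePlace k₀, v u ≤ 4 ^ j) → ∃ d e, (b, c + b * u, d, e) ∈ levelBox s K Y j ∧
      ∃ r : p.1, IsFormDatum (τ p.1) p.2 b (c + b * u) d e r}

theorem ncard_levelClasses_mul_le {𝓕 : Set (IntermediateField k₀ Ω)}
    {τ : ∀ F : IntermediateField k₀ Ω, F} (h2 : ∀ F ∈ 𝓕, finrank k₀ F = 2)
    (hτ : ∀ F ∈ 𝓕, τ F ≠ 0)
    {s : Finset (Ideal (𝓞 k₀))} (hs : ∀ p ∈ s, p.IsPrime ∧ p ≠ ⊥) {K Y : ℝ} (hK : 0 ≤ K)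
    (hY : 0 ≤ Y) (j : ℕ) :
    (levelClasses 𝓕 τ s K Y j).Finite ∧ ((levelClasses 𝓕 τ s K Y j).ncard : ℝ) *
      {u : 𝓞 k₀ | ∀ v : InfinitePlace k₀, v u ≤ 4 ^ j}.ncard ≤
      8 * 256 ^ finrank ℚ k₀ * 4 ^ s.card * (((K * Y) ^ finrank ℚ k₀) ^ 4 /
        Ideal.absNorm (∏ p ∈ s, p) + ((K * Y) ^ finrank ℚ k₀) ^ 3) * 2 := by
  set S := levelClasses 𝓕 τ s K Y j with hS
  set U := {u : 𝓞 k₀ | ∀ v : InfinitePlace k₀, v u ≤ 4 ^ j} with hU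
  obtain ⟨hA, ha⟩ := ncard_levelBox_le hs hK hY j
  choose! inst b c h using fun (p : Σ F : IntermediateField k₀ Ω, ClassGroup (𝓞 F))
    (hp : p ∈ S) => hp.2
  choose! d e hde r hr using h
  have key := Set.ncard_le_mul_of_fiber (S := S ×ˢ U)
    (f := fun x => (b x.1, c x.1 + b x.1 * x.2, d x.1 x.2, e x.1 x.2)) hA ha
    (fun x hx => hde x.1 hx.1 x.2 hx.2) zero_le_two fun f hf => ?_
  · have h0U : (0 : 𝓞 k₀) ∈ U := fun v => by simp
    rw [Set.ncard_prod, Nat.cast_mul] at key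
    refine ⟨(key.1.image Prod.fst).subset fun x hx => ⟨(x, 0), ⟨hx, h0U⟩, rfl⟩, key.2⟩
  · refine Set.ncard_le_two_of_sq (g := fun x => ((r x.1 x.2 : x.1.1) : Ω))
      (D := algebraMap k₀ Ω (cubicDisc f.1 f.2.1 f.2.2.1 f.2.2.2 : 𝓞 k₀)) ?_ ?_
    · rintro ⟨p, u⟩ ⟨⟨hp, hu⟩, rfl⟩
      have := inst p hp
      exact congrArg (fun t : p.1 => (t : Ω)) (hr p hp u hu).sq_eq
    · rintro ⟨⟨F, x⟩, u⟩ ⟨⟨hp, hu⟩, hpf⟩ ⟨⟨F', x'⟩, u'⟩ ⟨⟨hp', hu'⟩, hpf'⟩ heq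
      change (⟨F, x⟩ : Σ F : IntermediateField k₀ Ω, ClassGroup (𝓞 F)) ∈ S at hp
      change (⟨F', x'⟩ : Σ F : IntermediateField k₀ Ω, ClassGroup (𝓞 F)) ∈ S at hp'
      have i1 : NumberField F := inst _ hp
      have i2 : NumberField F' := inst _ hp'
      have h1 : IsFormDatum (τ F) x _ _ _ _ _ := hr _ hp u hu
      have h1' : IsFormDatum (τ F') x' _ _ _ _ _ := hr _ hp' u' hu'
      have hb := hde _ hp u hu
      replace hpf' := hpf.trans hpf'.symm
      dsimp only at heq hpf'
      obtain rfl : F = F' := by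
        rw [← eq_adjoin_of_finrank_eq_two (h2 F hp.1) h1.notMem,
          ← eq_adjoin_of_finrank_eq_two (h2 F' hp'.1) h1'.notMem, heq]
      have heq' := Subtype.ext heq
      simp only [Prod.mk.injEq] at hpf'
      obtain ⟨hpf1, hpf2, hpf3, hpf4⟩ := hpf'
      rw [← heq', ← hpf2, ← hpf1, ← hpf3, ← hpf4] at h1'
      obtain rfl : x = x' := h1.unique (hτ F hp.1) h1'
      have : b ⟨F, x⟩ * u = b ⟨F, x⟩ * u' := add_left_cancel hpf2
      rw [mul_left_cancel₀ hb.1 this]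

theorem ncard_iUnion_levelClasses_le {𝓕 : Set (IntermediateField k₀ Ω)}
    {τ : ∀ F : IntermediateField k₀ Ω, F} (h2 : ∀ F ∈ 𝓕, finrank k₀ F = 2)
    (hτ : ∀ F ∈ 𝓕, τ F ≠ 0)
    {s : Finset (Ideal (𝓞 k₀))} (hs : ∀ p ∈ s, p.IsPrime ∧ p ≠ ⊥) {K Y : ℝ} (hK : 0 ≤ K)
    (hY : 0 ≤ Y) {c : ℝ} (hc : 0 < c) (hcU : ∀ Z : ℝ, 1 ≤ Z →
      c * Z ^ finrank ℚ k₀ ≤ {u : 𝓞 k₀ | ∀ v : InfinitePlace k₀, v u ≤ Z}.ncard) :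
    (⋃ j, levelClasses 𝓕 τ s K Y j).Finite ∧ ((⋃ j, levelClasses 𝓕 τ s K Y j).ncard : ℝ) ≤
      32 / c * 256 ^ finrank ℚ k₀ * 4 ^ s.card * (((K * Y) ^ finrank ℚ k₀) ^ 4 /
        Ideal.absNorm (∏ p ∈ s, p) + ((K * Y) ^ finrank ℚ k₀) ^ 3) := by
  set A := 8 * 256 ^ finrank ℚ k₀ * 4 ^ s.card * (((K * Y) ^ finrank ℚ k₀) ^ 4 /
        Ideal.absNorm (∏ p ∈ s, p) + ((K * Y) ^ finrank ℚ k₀) ^ 3) * 2 with hA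
  have hA0 : 0 ≤ A := by positivity
  have hj : ∀ j, ((levelClasses 𝓕 τ s K Y j).ncard : ℝ) ≤ A / c * (1 / 2) ^ j := by
    intro j
    have h1 := (ncard_levelClasses_mul_le h2 hτ hs hK hY j).2
    have h3 : c * 2 ^ j ≤ ({u : 𝓞 k₀ | ∀ v : InfinitePlace k₀, v u ≤ 4 ^ j}.ncard : ℝ) := by
      refine le_trans ?_ (hcU (4 ^ j) (one_le_pow₀ (by norm_num)))
      gcongr
      calc (2 : ℝ) ^ j ≤ 4 ^ j := by gcongr; norm_num
        _ ≤ _ := le_self_pow₀ (one_le_pow₀ (by norm_num)) finrank_pos.ne'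
    rw [one_div, inv_pow, ← div_eq_mul_inv, div_div, le_div_iff₀ (by positivity)]
    exact (mul_le_mul_of_nonneg_left h3 (Nat.cast_nonneg _)).trans h1
  refine Set.finite_and_ncard_le_of_forall_finset fun T hT => ?_
  have hT' : ∀ p, ∃ j, p ∈ T → p ∈ levelClasses 𝓕 τ s K Y j := by
    intro p
    by_cases hp : p ∈ T
    · obtain ⟨j, hj⟩ := Set.mem_iUnion.1 (hT hp)
      exact ⟨j, fun _ => hj⟩
    · exact ⟨0, fun h => absurd h hp⟩
  choose f hf using hT'
  have h1 : (T.card : ℝ) = ∑ y ∈ T.image f, ((T.filter fun x => f x = y).card : ℝ) := by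
    exact_mod_cast Finset.card_eq_sum_card_image f T
  rw [h1]
  calc _ ≤ ∑ j ∈ T.image f, A / c * (1 / 2) ^ j := by
        refine Finset.sum_le_sum fun j _ => le_trans ?_ (hj j)
        have h4 := Set.ncard_le_ncard (s := ↑(T.filter fun z => f z = j)) (fun z hz => by
          obtain ⟨hzT, hzj⟩ := Finset.mem_filter.1 (Finset.mem_coe.1 hz)
          exact hzj ▸ hf z hzT) (ncard_levelClasses_mul_le h2 hτ hs hK hY j).1
        rw [Set.ncard_coe_finset] at h4
        exact_mod_cast h4
    _ = A / c * ∑ j ∈ T.image f, (1 / 2) ^ j := by rw [Finset.mul_sum]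
    _ ≤ A / c * 2 := by
        gcongr
        exact (summable_geometric_two.sum_le_tsum _ fun _ _ => by positivity).trans_eq
          tsum_geometric_two
    _ = _ := by rw [hA]; ring

end Quadratic

section Count

variable {k₀ : Type*} [Field k₀] [NumberField k₀]

theorem exists_absDisc_eq {F : IntermediateField k₀ (AlgebraicClosure k₀)}
    (h2 : finrank k₀ F = 2) : ∃ _ : NumberField F, (absDisc k₀ F : ℝ) = |(discr F : ℝ)| := by
  have h : FiniteDimensional k₀ F := FiniteDimensional.of_finrank_pos (by omega)
  have : CharZero F := (algebraMap F (AlgebraicClosure k₀)).charZero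
  have : IsScalarTower ℚ k₀ F := IsScalarTower.of_algebraMap_eq' (Subsingleton.elim _ _)
  have : FiniteDimensional ℚ F := Module.Finite.trans k₀ F
  refine ⟨⟨⟩, ?_⟩
  rw [absDisc, dif_pos h, Nat.cast_natAbs, Int.cast_abs]

/-- Quadratic extensions of bounded discriminant ramified at all primes in `s`. -/
def ramifiedQuadratics (s : Finset (Ideal (𝓞 k₀))) (X : ℝ) :
    Set (IntermediateField k₀ (AlgebraicClosure k₀)) :=
  {F | finrank k₀ F = 2 ∧ (absDisc k₀ F : ℝ) ≤ X ∧ ∀ p ∈ s, ∃ P : Ideal (𝓞 F), P.IsPrime ∧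
    p.map (algebraMap (𝓞 k₀) (𝓞 F)) = P ^ 2}

variable {s : Finset (Ideal (𝓞 k₀))} {Y : ℝ}

theorem exists_adjoin_eq_of_mem_ramifiedQuadratics (hs : ∀ p ∈ s, p.IsPrime ∧ p ≠ ⊥) (hY : 0 ≤ Y)
    {F : IntermediateField k₀ (AlgebraicClosure k₀)}
    (hF : F ∈ ramifiedQuadratics s (Y ^ (4 * finrank ℚ k₀))) :
    ∃ (r : AlgebraicClosure k₀) (d : 𝓞 k₀), IntermediateField.adjoin k₀ {r} = F ∧
      r ^ 2 = algebraMap k₀ (AlgebraicClosure k₀) d ∧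
      d ∈ ∏ p ∈ s, p ∧ d ≠ 0 ∧ ∀ v : InfinitePlace k₀, v d ≤ 256 * Y ^ 4 := by
  obtain ⟨h2, hX, hram⟩ := hF
  obtain ⟨_, hdisc⟩ := exists_absDisc_eq h2
  obtain ⟨r, d, hr, hrd, hd, hd0, hdv⟩ := exists_small_generator h2 hY (hdisc ▸ hX) hs hram
  exact ⟨r, d, eq_adjoin_of_finrank_eq_two h2 hr, congrArg (fun t : F => (t : AlgebraicClosure k₀))
    hrd, hd, hd0, hdv⟩

theorem absNorm_le_of_ramifiedQuadratics_nonempty (hs : ∀ p ∈ s, p.IsPrime ∧ p ≠ ⊥) (hY : 0 ≤ Y)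
    (h : (ramifiedQuadratics s (Y ^ (4 * finrank ℚ k₀))).Nonempty) :
    (Ideal.absNorm (∏ p ∈ s, p) : ℝ) ≤ (256 * Y ^ 4) ^ finrank ℚ k₀ := by
  obtain ⟨F, hF⟩ := h
  obtain ⟨r, d, -, -, hd, hd0, hdv⟩ := exists_adjoin_eq_of_mem_ramifiedQuadratics hs hY hF
  exact absNorm_le_of_mem hd hd0 hdv

theorem ncard_ramifiedQuadratics_le (hs : ∀ p ∈ s, p.IsPrime ∧ p ≠ ⊥) (hY : 0 ≤ Y) :
    (ramifiedQuadratics s (Y ^ (4 * finrank ℚ k₀))).Finite ∧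
    ((ramifiedQuadratics s (Y ^ (4 * finrank ℚ k₀))).ncard : ℝ) ≤
      2 * 4 ^ finrank ℚ k₀ * ((256 * Y ^ 4) ^ finrank ℚ k₀ / Ideal.absNorm (∏ p ∈ s, p)) * 2 := by
  choose! r d hr hrd hd hd0 hdv using
    fun (F : IntermediateField k₀ (AlgebraicClosure k₀)) hF =>
      exists_adjoin_eq_of_mem_ramifiedQuadratics (F := F) hs hY hF
  obtain ⟨hA, ha⟩ := ncard_ideal_le (prod_ne_bot hs) (Z := 256 * Y ^ 4) (by positivity)
  refine Set.ncard_le_mul_of_fiber (f := d) hA ha (fun F hF => ⟨hd F hF, hd0 F hF, hdv F hF⟩)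
    zero_le_two fun y _ => Set.ncard_le_two_of_sq (g := r) (D := algebraMap k₀ _ (y : k₀)) ?_ ?_
  · rintro F ⟨hF, rfl⟩
    exact hrd F hF
  · rintro F ⟨hF, -⟩ F' ⟨hF', -⟩ heq
    rw [← hr F hF, ← hr F' hF', heq]

variable (s Y) in
/-- The `3`-torsion classes of the fields in `ramifiedQuadratics`. -/
def torsionClasses : Set (Σ F : IntermediateField k₀ (AlgebraicClosure k₀), ClassGroup (𝓞 F)) :=
  {p | p.1 ∈ ramifiedQuadratics s (Y ^ (4 * finrank ℚ k₀)) ∧ p.2 ^ 3 = 1}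

theorem ncard_torsionClasses_le (hs : ∀ p ∈ s, p.IsPrime ∧ p ≠ ⊥) (hY : 0 ≤ Y) {c : ℝ}
    (hc : 0 < c) (hcU : ∀ Z : ℝ, 1 ≤ Z →
      c * Z ^ finrank ℚ k₀ ≤ {u : 𝓞 k₀ | ∀ v : InfinitePlace k₀, v u ≤ Z}.ncard) :
    (torsionClasses s Y).Finite ∧ ((torsionClasses s Y).ncard : ℝ) ≤
      32 / c * 256 ^ finrank ℚ k₀ * 4 ^ s.card *
        (((27 * conjBound k₀ ^ 2 * Y) ^ finrank ℚ k₀) ^ 4 / Ideal.absNorm (∏ p ∈ s, p) +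
          ((27 * conjBound k₀ ^ 2 * Y) ^ finrank ℚ k₀) ^ 3) +
      2 * 4 ^ finrank ℚ k₀ * ((256 * Y ^ 4) ^ finrank ℚ k₀ / Ideal.absNorm (∏ p ∈ s, p)) * 2 *
        Nat.card (ClassGroup (𝓞 k₀)) := by
  set 𝓕 := ramifiedQuadratics s (Y ^ (4 * finrank ℚ k₀)) with h𝓕
  obtain ⟨hF, hFc⟩ := ncard_ramifiedQuadratics_le hs hY
  have hex : ∀ F : IntermediateField k₀ (AlgebraicClosure k₀), ∃ τ : F, F ∈ 𝓕 → τ ≠ 0 ∧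
      ∃ _ : NumberField F, ∀ x : ClassGroup (𝓞 F), x ^ 3 = 1 →
      x ∈ (ClassGroup.extendedHom (𝓞 k₀) (𝓞 F)).range ∨
      ∃ (j : ℕ) (b c : 𝓞 k₀), ∀ u : 𝓞 k₀, (∀ v : InfinitePlace k₀, v u ≤ 4 ^ j) →
        ∃ d e, (b, c + b * u, d, e) ∈ levelBox s (27 * conjBound k₀ ^ 2) Y j ∧
          ∃ r : F, IsFormDatum τ x b (c + b * u) d e r := by
    intro F
    by_cases hF : F ∈ 𝓕
    · obtain ⟨_, hdisc⟩ := exists_absDisc_eq hF.1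
      obtain ⟨τ, hτ0, hτ⟩ := exists_forms hF.1 hY (hdisc ▸ hF.2.1) hs hF.2.2
      exact ⟨τ, fun _ => ⟨hτ0, ‹_›, hτ⟩⟩
    · exact ⟨0, fun h => absurd h hF⟩
  choose τ hτ using hex
  obtain ⟨hS, hSc⟩ := ncard_iUnion_levelClasses_le (𝓕 := 𝓕) (τ := τ) (fun F hF => hF.1)
    (fun F hF => (hτ F hF).1) hs (K := 27 * conjBound k₀ ^ 2) (by positivity) hY hc hcU
  let R : Set (Σ F : IntermediateField k₀ (AlgebraicClosure k₀), ClassGroup (𝓞 F)) :=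
    {p | p.1 ∈ 𝓕 ∧ ∃ _ : NumberField p.1, p.2 ∈ (ClassGroup.extendedHom (𝓞 k₀) (𝓞 p.1)).range}
  have hR : R.Finite ∧ (R.ncard : ℝ) ≤ 2 * 4 ^ finrank ℚ k₀ *
      ((256 * Y ^ 4) ^ finrank ℚ k₀ / Ideal.absNorm (∏ p ∈ s, p)) * 2 *
        Nat.card (ClassGroup (𝓞 k₀)) := by
    refine Set.ncard_le_mul_of_fiber (f := Sigma.fst) hF hFc (fun p hp => hp.1)
      (Nat.cast_nonneg _) fun F hF => ?_
    obtain ⟨-, _, -⟩ := hτ F hF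
    have hsub : {p ∈ R | p.1 = F} ⊆ Set.range
        (fun y : ClassGroup (𝓞 k₀) => (⟨F, ClassGroup.extendedHom (𝓞 k₀) (𝓞 F) y⟩ :
          Σ F : IntermediateField k₀ (AlgebraicClosure k₀), ClassGroup (𝓞 F))) := by
      rintro ⟨F, x⟩ ⟨⟨-, -, y, hy⟩, rfl⟩
      exact ⟨y, congrArg (Sigma.mk F) hy⟩
    have hfin := Set.finite_range
        (fun y : ClassGroup (𝓞 k₀) => (⟨F, ClassGroup.extendedHom (𝓞 k₀) (𝓞 F) y⟩ :
          Σ F : IntermediateField k₀ (AlgebraicClosure k₀), ClassGroup (𝓞 F)))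
    refine ⟨hfin.subset hsub, ?_⟩
    rw [← Set.image_univ] at hsub hfin
    have h1 := (Set.ncard_le_ncard hsub hfin).trans (Set.ncard_image_le Set.finite_univ)
    rw [Set.ncard_univ] at h1
    exact_mod_cast h1
  have hsub : torsionClasses s Y ⊆ (⋃ j, levelClasses 𝓕 τ s (27 * conjBound k₀ ^ 2) Y j) ∪ R := by
    rintro ⟨F, x⟩ ⟨hF, hx⟩
    obtain ⟨-, hnf, h⟩ := hτ F hF
    rcases h x hx with h | ⟨j, b, c, h⟩
    · exact Or.inr ⟨hF, hnf, h⟩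
    · exact Or.inl (Set.mem_iUnion.2 ⟨j, hF, hnf, b, c, h⟩)
  refine ⟨(hS.union hR.1).subset hsub, ?_⟩
  have h1 := (Set.ncard_le_ncard hsub (hS.union hR.1)).trans (Set.ncard_union_le _ _)
  have h2 : ((torsionClasses s Y).ncard : ℝ) ≤
      (⋃ j, levelClasses 𝓕 τ s (27 * conjBound k₀ ^ 2) Y j).ncard + R.ncard := by
    exact_mod_cast h1
  exact h2.trans (add_le_add hSc hR.2)

theorem finsum_relThreeClassNumber_le (hfin : (torsionClasses s Y).Finite) :
    ∑ᶠ F ∈ ramifiedQuadratics s (Y ^ (4 * finrank ℚ k₀)), relThreeClassNumber k₀ F ≤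
      (torsionClasses s Y).ncard := by
  set 𝓕 := ramifiedQuadratics s (Y ^ (4 * finrank ℚ k₀)) with h𝓕
  have hF : 𝓕.Finite := (hfin.image Sigma.fst).subset fun F hF => ⟨⟨F, 1⟩, ⟨hF, one_pow 3⟩, rfl⟩
  rw [finsum_mem_eq_finite_toFinset_sum _ hF, Set.ncard_eq_toFinset_card _ hfin,
    Finset.card_eq_sum_card_fiberwise (f := Sigma.fst) (t := hF.toFinset) (fun p hp => by
      have hp := hfin.mem_toFinset.1 (Finset.mem_coe.1 hp)
      exact Finset.mem_coe.2 (hF.mem_toFinset.2 hp.1)), Nat.cast_sum]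
  refine Finset.sum_le_sum fun F hFF => ?_
  have hcard : Nat.card {x : ClassGroup (𝓞 F) // x ^ 3 = 1} =
      (hfin.toFinset.filter fun p => p.1 = F).card := by
    have h1 : ((hfin.toFinset.filter fun p => p.1 = F : Finset _) :
        Set (Σ F : IntermediateField k₀ (AlgebraicClosure k₀), ClassGroup (𝓞 F))) =
        Sigma.mk F '' {x | x ^ 3 = 1} := by
      ext ⟨F', x⟩
      simp only [Finset.coe_filter, Set.Finite.mem_toFinset, Set.mem_ofPred_eq, Set.mem_image]
      constructor
      · rintro ⟨⟨-, hx⟩, rfl⟩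
        exact ⟨x, hx, rfl⟩
      · rintro ⟨y, hy, heq⟩
        cases heq
        exact ⟨⟨hF.mem_toFinset.1 hFF, hy⟩, rfl⟩
    rw [← Set.ncard_coe_finset, h1, Set.ncard_image_of_injective _ sigma_mk_injective]
    rfl
  rw [relThreeClassNumber, hcard]
  refine div_le_self (Nat.cast_nonneg _) ?_
  have : Nonempty {x : ClassGroup (𝓞 k₀) // x ^ 3 = 1} := ⟨⟨1, one_pow 3⟩⟩
  exact Nat.one_le_cast.2 Nat.card_pos

end Count

theorem exists_pow_card_le (k₀ : Type*) [Field k₀] [NumberField k₀] :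
    ∃ C : ℝ, 0 < C ∧ ∀ s : Finset (Ideal (𝓞 k₀)), (∀ p ∈ s, p.IsPrime ∧ p ≠ ⊥) →
      (4 : ℝ) ^ s.card ≤ C * (Ideal.absNorm (∏ p ∈ s, p) : ℝ) ^ ((1 : ℝ) / 12) := by
  have hfin : {I : Ideal (𝓞 k₀) | Ideal.absNorm I ≤ 4 ^ 12}.Finite :=
    Ideal.finite_setOfPred_absNorm_le _
  set B := hfin.toFinset
  refine ⟨4 ^ B.card, by positivity, fun s hs => ?_⟩
  have h1 : ∀ p ∈ s, (4 : ℝ) ≤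
      (if p ∈ B then 4 else 1) * (Ideal.absNorm p : ℝ) ^ ((1 : ℝ) / 12) := by
    intro p hp
    have hp1 : Ideal.absNorm p ≠ 0 := by
      rw [Ne, Ideal.absNorm_eq_zero_iff]; exact (hs p hp).2
    split_ifs with hB
    · have : (1 : ℝ) ≤ (Ideal.absNorm p : ℝ) ^ ((1 : ℝ) / 12) :=
        Real.one_le_rpow (by exact_mod_cast Nat.one_le_iff_ne_zero.2 hp1) (by norm_num)
      linarith
    · have h2 : 4 ^ 12 ≤ Ideal.absNorm p := by
        by_contra! h
        exact hB (hfin.mem_toFinset.2 h.le)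
      have h3 : ((4 : ℝ) ^ 12) ^ ((1 : ℝ) / 12) ≤ (Ideal.absNorm p : ℝ) ^ ((1 : ℝ) / 12) :=
        Real.rpow_le_rpow (by positivity) (by exact_mod_cast h2) (by norm_num)
      have h4 : ((4 : ℝ) ^ 12) ^ ((1 : ℝ) / 12) = 4 := by
        rw [← Real.rpow_natCast, ← Real.rpow_mul (by norm_num)]; norm_num
      linarith
  calc (4 : ℝ) ^ s.card = ∏ _p ∈ s, (4 : ℝ) := by rw [Finset.prod_const]
    _ ≤ ∏ p ∈ s, (if p ∈ B then 4 else 1) * (Ideal.absNorm p : ℝ) ^ ((1 : ℝ) / 12) :=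
        Finset.prod_le_prod (fun _ _ => by norm_num) h1
    _ = 4 ^ (s.filter (· ∈ B)).card * (Ideal.absNorm (∏ p ∈ s, p) : ℝ) ^ ((1 : ℝ) / 12) := by
        rw [Finset.prod_mul_distrib, ← Finset.prod_filter, Finset.prod_const,
          Real.finsetProd_rpow _ _ (fun _ _ => Nat.cast_nonneg _), map_prod, Nat.cast_prod]
    _ ≤ _ := by
        gcongr
        · norm_num
        · exact fun p hp => (Finset.mem_filter.1 hp).2

/-- The final numerical estimate. -/
theorem uniformity_numeric {ρ W a t C₁ L M m : ℝ} (hρ : 1 ≤ ρ) (hW : 0 ≤ W) (hρW : ρ ^ 3 ≤ a * W)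
    (ht : t ≤ C₁ * ρ) (hC₁ : 0 ≤ C₁) (hL : 0 ≤ L) (hM : 0 ≤ M) (hm : 0 ≤ m) :
    M * t * ((L * W) ^ 4 / ρ ^ 12 + (L * W) ^ 3) + m * (W ^ 4 / ρ ^ 12) ≤
      (M * C₁ * (L ^ 4 + a * L ^ 3) + m) * (W ^ 4 / ρ ^ 2) := by
  have hρ0 : 0 < ρ := by linarith
  have h1 : W ^ 4 / ρ ^ 12 ≤ W ^ 4 / ρ ^ 3 := by gcongr; norm_num
  have h2 : W ^ 4 / ρ ^ 12 ≤ W ^ 4 / ρ ^ 2 := by gcongr; norm_num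
  have h3 : W ^ 3 ≤ a * (W ^ 4 / ρ ^ 3) := by
    rw [← mul_div_assoc, le_div_iff₀ (by positivity)]
    calc W ^ 3 * ρ ^ 3 ≤ W ^ 3 * (a * W) := by gcongr
      _ = _ := by ring
  have h4 : (L * W) ^ 4 / ρ ^ 12 + (L * W) ^ 3 ≤ (L ^ 4 + a * L ^ 3) * (W ^ 4 / ρ ^ 3) := by
    calc _ = L ^ 4 * (W ^ 4 / ρ ^ 12) + L ^ 3 * W ^ 3 := by ring
      _ ≤ L ^ 4 * (W ^ 4 / ρ ^ 3) + L ^ 3 * (a * (W ^ 4 / ρ ^ 3)) := by gcongr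
      _ = _ := by ring
  calc _ ≤ M * (C₁ * ρ) * ((L ^ 4 + a * L ^ 3) * (W ^ 4 / ρ ^ 3)) + m * (W ^ 4 / ρ ^ 2) := by
        gcongr
    _ = _ := by field_simp

end Auxiliary

/-- **Uniformity estimate for `3`-class numbers of quadratic extensions** (Corollary 3.3).
For every `ε > 0` there is a constant `C` (depending only on `k` and `ε`) such that for
every squarefree integral ideal `q` of `𝒪_k` and every `X ≥ 1`, the sum of the relative
`3`-class numbers `h3*(F/k)` over all quadratic extensions `F/k` (each isomorphism class
of quadratic extensions of `k` is represented by exactly one intermediate field of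
`kbar/k`, since quadratic extensions are Galois) with `q ∣ disc(F/k)` (i.e. every prime
dividing the squarefree ideal `q` is ramified in `F`) and `Disc(F) ≤ X` is at most
`C · X / |q|^(1/6 - ε)`. -/
theorem class_number_uniformity (k : Type*) [Field k] [NumberField k]
    (ε : ℝ) (hε : 0 < ε) :
    ∃ C : ℝ, 0 < C ∧ ∀ q : Ideal (𝓞 k), Squarefree q → ∀ X : ℝ, 1 ≤ X →
      (∑ᶠ F ∈ {F : IntermediateField k (AlgebraicClosure k) |
          Module.finrank k F = 2 ∧ (absDisc k F : ℝ) ≤ X ∧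
          ∀ p : Ideal (𝓞 k), p.IsPrime → p ∣ q →
            ∃ P : Ideal (𝓞 F), P.IsPrime ∧
              Ideal.map (algebraMap (𝓞 k) (𝓞 F)) p = P ^ 2},
        relThreeClassNumber k F)
        ≤ C * X / (Ideal.absNorm q : ℝ) ^ ((1 : ℝ) / 6 - ε) := by
  obtain ⟨c, hc, hcU⟩ := exists_le_ncard_box k
  obtain ⟨C₁, hC₁, h4⟩ := exists_pow_card_le k
  set n := Module.finrank ℚ k with hn
  have hn0 : 4 * n ≠ 0 := mul_ne_zero four_ne_zero Module.finrank_pos.ne'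
  set L : ℝ := (27 * conjBound k ^ 2) ^ n with hL
  set M : ℝ := 32 / c * 256 ^ n with hM
  set m : ℝ := 2 * 4 ^ n * 256 ^ n * 2 * Nat.card (ClassGroup (𝓞 k)) with hm
  have hcb := conjBound_pos k
  have hL0 : 0 < L := by positivity
  refine ⟨M * C₁ * (L ^ 4 + 4 ^ n * L ^ 3) + m, by positivity, fun q hq X hX => ?_⟩
  have hq0 : q ≠ 0 := hq.ne_zero
  set s := (UniqueFactorizationMonoid.normalizedFactors q).toFinset with hs_def
  have hmem : ∀ p, p ∈ s ↔ Prime p ∧ p ∣ q := fun p => by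
    rw [hs_def, Multiset.mem_toFinset, UniqueFactorizationMonoid.mem_normalizedFactors_iff hq0]
  have hs : ∀ p ∈ s, p.IsPrime ∧ p ≠ ⊥ := fun p hp =>
    ⟨Ideal.isPrime_of_prime ((hmem p).1 hp).1, ((hmem p).1 hp).1.ne_zero⟩
  have hprod : ∏ p ∈ s, p = q := by
    have hnd := (UniqueFactorizationMonoid.squarefree_iff_nodup_normalizedFactors hq0).1 hq
    rw [Finset.prod_eq_multiset_prod, hs_def, Multiset.toFinset_val, hnd.dedup, Multiset.map_id',
      Ideal.prod_normalizedFactors_eq_self hq0]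
  set Y : ℝ := X ^ ((4 * n : ℕ) : ℝ)⁻¹ with hY
  have hX0 : 0 ≤ X := zero_le_one.trans hX
  have hY0 : 0 ≤ Y := Real.rpow_nonneg hX0 _
  have hYX : Y ^ (4 * n) = X := Real.rpow_inv_natCast_pow hX0 hn0
  have hset : {F : IntermediateField k (AlgebraicClosure k) |
      Module.finrank k F = 2 ∧ (absDisc k F : ℝ) ≤ X ∧
      ∀ p : Ideal (𝓞 k), p.IsPrime → p ∣ q → ∃ P : Ideal (𝓞 F), P.IsPrime ∧
        Ideal.map (algebraMap (𝓞 k) (𝓞 F)) p = P ^ 2} = ramifiedQuadratics s (Y ^ (4 * n)) := by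
    rw [hYX]
    ext F
    refine and_congr_right fun _ => and_congr_right fun _ => forall_congr' fun p => ?_
    rw [hmem, and_imp]
    refine ⟨fun h hp => h (Ideal.isPrime_of_prime hp), fun h hp hpq => ?_⟩
    exact h (Ideal.prime_of_isPrime (by rintro rfl; exact hq0 (zero_dvd_iff.1 hpq)) hp) hpq
  have hN : (1 : ℝ) ≤ Ideal.absNorm q := by
    exact_mod_cast Nat.one_le_iff_ne_zero.2 fun h => hq0 (Ideal.absNorm_eq_zero_iff.1 h)
  have hN0 : (0 : ℝ) ≤ Ideal.absNorm q := zero_le_one.trans hN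
  rw [hset]
  rcases (ramifiedQuadratics s (Y ^ (4 * n))).eq_empty_or_nonempty with hempty | hne
  · rw [hempty, finsum_mem_empty]
    positivity
  have hNX := absNorm_le_of_ramifiedQuadratics_nonempty hs hY0 hne
  obtain ⟨hfin, hcount⟩ := ncard_torsionClasses_le hs hY0 hc hcU
  refine (finsum_relThreeClassNumber_le hfin).trans (hcount.trans ?_)
  specialize h4 s hs
  rw [hprod] at hNX h4 ⊢
  set ρ : ℝ := (Ideal.absNorm q : ℝ) ^ ((1 : ℝ) / 12) with hρ
  have hρ1 : 1 ≤ ρ := Real.one_le_rpow hN (by norm_num)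
  have hρN : ρ ^ 12 = Ideal.absNorm q := by
    rw [hρ, ← Real.rpow_natCast, ← Real.rpow_mul hN0]; norm_num
  have hρ2 : ρ ^ 2 = (Ideal.absNorm q : ℝ) ^ ((1 : ℝ) / 6) := by
    rw [hρ, ← Real.rpow_natCast, ← Real.rpow_mul hN0]; norm_num
  have h256 : (256 : ℝ) ^ n = (4 ^ n) ^ 4 := by rw [← pow_mul, mul_comm, pow_mul]; norm_num
  have hW4 : (Y ^ n) ^ 4 = X := by rw [← hYX, ← pow_mul, mul_comm]
  have hY4 : (256 * Y ^ 4) ^ n = 256 ^ n * (Y ^ n) ^ 4 := by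
    rw [mul_pow, ← pow_mul, ← pow_mul, mul_comm 4]
  have hρW : ρ ^ 3 ≤ 4 ^ n * Y ^ n := by
    refine le_of_pow_le_pow_left₀ four_ne_zero (by positivity) ?_
    rw [← pow_mul, mul_pow, ← h256, ← hY4]
    exact hρN.trans_le hNX
  calc _ = M * 4 ^ s.card * ((L * Y ^ n) ^ 4 / ρ ^ 12 + (L * Y ^ n) ^ 3) +
        m * ((Y ^ n) ^ 4 / ρ ^ 12) := by
        rw [hρN, hY4, hL, ← mul_pow, hM, hm]
        ring
    _ ≤ _ := uniformity_numeric hρ1 (by positivity) hρW h4 hC₁.le hL0.le (by positivity)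
        (by positivity)
    _ = (M * C₁ * (L ^ 4 + 4 ^ n * L ^ 3) + m) * X / (Ideal.absNorm q : ℝ) ^ ((1 : ℝ) / 6) := by
        rw [hW4, hρ2, mul_div_assoc]
    _ ≤ _ := by
        gcongr
        linarith
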